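/- arXiv:2408.01237 — 3 statements merged into one kernel-verified Lean document; each statement's English description precedes it below -/
import Mathlib

section
/- Let X ~ IDD(μ, 0, ν) with μ = ∫_ℝ u ν(du) < ∞ (in particular E[X] = μ), and let w : ℝ → [0,∞) be an absolutely continuous function with 0 < E[w(X)] < ∞, E[|X w(X)|] < ∞ and E[ ∫_ℝ |w(X+u) u| ν(du) ] < ∞. Then E[X w(X)] = E[ ∫_ℝ w(X+u) u ν(du) ]; equivalently, the weighted premium H_w(X) := E[X w(X)] / E[w(X)] satisfies H_w(X) = E[ ∫_ℝ w(X+u) u ν(du) ] / E[w(X)]. -/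
open MeasureTheory ProbabilityTheory Set
open Filter Topology
open scoped ENNReal

namespace WP

/-- iterated convolution powers -/
noncomputable def cpow (ν : Measure ℝ) : ℕ → Measure ℝ
  | 0 => Measure.dirac 0
  | n + 1 => ν ∗ cpow ν n

instance cpow_fin (ν : Measure ℝ) [IsFiniteMeasure ν] (n : ℕ) : IsFiniteMeasure (cpow ν n) := by
  induction n with
  | zero => unfold cpow; infer_instance
  | succ n ih => unfold cpow; infer_instance

lemma cpow_univ (ν : Measure ℝ) [IsFiniteMeasure ν] (n : ℕ) : cpow ν n univ = (ν univ) ^ n := by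
  induction n with
  | zero => simp [cpow]
  | succ n ih =>
    rw [cpow, Measure.conv, Measure.map_apply (by fun_prop) MeasurableSet.univ]
    rw [preimage_univ, ← univ_prod_univ, Measure.prod_prod, ih, pow_succ']

lemma charFun_cpow (ν : Measure ℝ) [IsFiniteMeasure ν] (n : ℕ) (t : ℝ) :
    charFun (cpow ν n) t = (charFun ν t) ^ n := by
  induction n with
  | zero => simp [cpow, charFun_dirac]
  | succ n ih => rw [cpow, charFun_conv, ih, pow_succ']

lemma lintegral_cpow (ν : Measure ℝ) [IsFiniteMeasure ν] (n : ℕ) :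
    ∫⁻ x, ‖x‖ₑ ∂(cpow ν n) ≤ n * (ν univ) ^ (n - 1) * ∫⁻ u, ‖u‖ₑ ∂ν := by
  induction n with
  | zero => simp [cpow]
  | succ n ih =>
    rw [cpow, Measure.lintegral_conv (by fun_prop)]
    calc ∫⁻ x, ∫⁻ y, ‖x + y‖ₑ ∂(cpow ν n) ∂ν
        ≤ ∫⁻ x, ∫⁻ y, (‖x‖ₑ + ‖y‖ₑ) ∂(cpow ν n) ∂ν := by
          gcongr; exact enorm_add_le _ _
      _ = (∫⁻ x, ‖x‖ₑ ∂ν) * (ν univ) ^ n + (∫⁻ y, ‖y‖ₑ ∂(cpow ν n)) * ν univ := by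
          simp_rw [lintegral_add_right _ measurable_enorm, lintegral_const, cpow_univ]
          rw [lintegral_add_right _ measurable_const, lintegral_mul_const _ measurable_enorm,
            lintegral_const]
      _ ≤ (∫⁻ x, ‖x‖ₑ ∂ν) * (ν univ) ^ n +
            (n * (ν univ) ^ (n - 1) * ∫⁻ u, ‖u‖ₑ ∂ν) * ν univ := by gcongr
      _ = _ := by
          rcases n with _ | n
          · simp
          · simp only [Nat.add_sub_cancel]; push_cast; ring

/-- compound Poisson law with intensity `ν` -/
noncomputable def cpois (ν : Measure ℝ) : Measure ℝ :=
  Measure.sum fun n => ENNReal.ofReal (Real.exp (-(ν.real univ)) / n.factorial) • cpow ν n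

lemma exp_hasSum (l : ℝ) : HasSum (fun n : ℕ => Real.exp (-l) / n.factorial * l ^ n) 1 := by
  have h := (NormedSpace.expSeries_div_hasSum_exp (𝔸 := ℝ) l).mul_left (Real.exp (-l))
  rw [← Real.exp_eq_exp_ℝ, ← Real.exp_add] at h
  simp only [neg_add_cancel, Real.exp_zero] at h
  have e : (fun n : ℕ => Real.exp (-l) / n.factorial * l ^ n) =
      fun n : ℕ => Real.exp (-l) * (l ^ n / n.factorial) := by
    ext n; ring
  rw [e]; exact h

lemma exp_tsum (l : ℝ) (hl : 0 ≤ l) :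
    ∑' n : ℕ, ENNReal.ofReal (Real.exp (-l) / n.factorial) * (ENNReal.ofReal l) ^ n = 1 := by
  have h := exp_hasSum l
  have : ∀ n : ℕ, ENNReal.ofReal (Real.exp (-l) / n.factorial) * (ENNReal.ofReal l) ^ n
      = ENNReal.ofReal (Real.exp (-l) / n.factorial * l ^ n) := by
    intro n
    rw [ENNReal.ofReal_mul (by positivity), ENNReal.ofReal_pow hl]
  simp_rw [this]
  rw [← ENNReal.ofReal_tsum_of_nonneg (fun n => by positivity) h.summable, h.tsum_eq]
  simp

instance cpois_prob (ν : Measure ℝ) [IsFiniteMeasure ν] : IsProbabilityMeasure (cpois ν) := by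
  constructor
  rw [cpois, Measure.sum_apply _ MeasurableSet.univ]
  simp only [Measure.smul_apply, smul_eq_mul, cpow_univ]
  have := exp_tsum (ν.real univ) measureReal_nonneg
  rwa [ofReal_measureReal] at this

lemma charFun_cpois (ν : Measure ℝ) [IsFiniteMeasure ν] (t : ℝ) :
    charFun (cpois ν) t = Complex.exp (charFun ν t - ν.real univ) := by
  have hI : Integrable (fun x : ℝ => Complex.exp (t * x * Complex.I)) (cpois ν) := by
    refine Integrable.of_bound (by fun_prop) 1 (ae_of_all _ fun x => ?_)
    rw [← Complex.ofReal_mul, Complex.norm_exp_ofReal_mul_I]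
  have h := hasSum_integral_measure (μ := fun n => ENNReal.ofReal (Real.exp (-(ν.real univ)) / n.factorial) • cpow ν n) hI
  change HasSum _ (∫ x, _ ∂(cpois ν)) at h
  rw [← charFun_apply_real] at h
  have h2 := (NormedSpace.expSeries_div_hasSum_exp (𝔸 := ℂ) (charFun ν t)).mul_left (Complex.exp (-(ν.real univ)))
  rw [← Complex.exp_eq_exp_ℂ, ← Complex.exp_add] at h2
  rw [sub_eq_neg_add]
  refine h.unique ?_
  rw [show (fun n : ℕ => ∫ x : ℝ, Complex.exp (t * x * Complex.I) ∂(ENNReal.ofReal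
    (Real.exp (-(ν.real univ)) / n.factorial) • cpow ν n)) =
      fun n : ℕ => Complex.exp (-(ν.real univ)) * (charFun ν t ^ n / n.factorial) from ?_]
  · exact h2
  ext n
  rw [integral_smul_measure, ← charFun_apply_real, charFun_cpow,
    ENNReal.toReal_ofReal (by positivity), Complex.real_smul]
  push_cast
  ring

lemma lintegral_cpois (ν : Measure ℝ) [IsFiniteMeasure ν] :
    ∫⁻ x, ‖x‖ₑ ∂(cpois ν) ≤ ∫⁻ u, ‖u‖ₑ ∂ν := by
  rw [cpois, lintegral_sum_measure]
  simp only [lintegral_smul_measure, smul_eq_mul]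
  calc _ ≤ ∑' n : ℕ, ENNReal.ofReal (Real.exp (-(ν.real univ)) / n.factorial) *
        (n * (ν univ) ^ (n - 1) * ∫⁻ u, ‖u‖ₑ ∂ν) := by
        gcongr; exact lintegral_cpow ν _
    _ = (∑' n : ℕ, ENNReal.ofReal (Real.exp (-(ν.real univ)) / n.factorial) * (n * (ν univ) ^ (n - 1))) * ∫⁻ u, ‖u‖ₑ ∂ν := by
        rw [← ENNReal.tsum_mul_right]; simp_rw [mul_assoc]
    _ = 1 * ∫⁻ u, ‖u‖ₑ ∂ν := by
        congr 1
        rw [tsum_eq_zero_add' ENNReal.summable]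
        have := exp_tsum (ν.real univ) measureReal_nonneg
        rw [ofReal_measureReal] at this
        simp only [Nat.cast_zero, zero_mul, mul_zero, zero_add, Nat.add_sub_cancel]
        rw [← this]
        congr 1; ext n
        rw [← mul_assoc, ← ENNReal.ofReal_natCast, ← ENNReal.ofReal_mul (by positivity)]
        congr 2
        rw [Nat.factorial_succ]; push_cast
        field_simp
    _ = _ := one_mul _

/-- Lévy exponent -/
noncomputable def psi (ν : Measure ℝ) (t : ℝ) : ℂ :=
  ∫ u : ℝ, (Complex.exp (t * u * Complex.I) - 1) ∂ν

lemma bound1 (t u : ℝ) : ‖Complex.exp (t * u * Complex.I) - 1‖ ≤ |t| * |u| := by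
  have := Real.norm_exp_I_mul_ofReal_sub_one_le (x := t * u)
  rw [Real.norm_eq_abs, abs_mul] at this
  convert this using 3
  push_cast; ring_nf

lemma int1 (ν : Measure ℝ) (h : Integrable (fun u : ℝ => u) ν) (t : ℝ) :
    Integrable (fun u : ℝ => Complex.exp (t * u * Complex.I) - 1) ν := by
  refine Integrable.mono' (h.abs.const_mul |t|) (by fun_prop) (ae_of_all _ fun u => bound1 t u)

lemma psi_deriv (ν : Measure ℝ) (h : Integrable (fun u : ℝ => u) ν) (t : ℝ) :
    HasDerivAt (psi ν) (∫ u : ℝ, Complex.exp (t * u * Complex.I) * (u * Complex.I) ∂ν) t := by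
  refine (hasDerivAt_integral_of_dominated_loc_of_deriv_le (μ := ν) (x₀ := t) (s := univ)
    (F := fun (t : ℝ) (u : ℝ) => Complex.exp (t * u * Complex.I) - 1)
    (F' := fun (t : ℝ) (u : ℝ) => Complex.exp (t * u * Complex.I) * (u * Complex.I))
    (bound := fun u => |u|) univ_mem ?_ (int1 ν h t) (by fun_prop) ?_ h.abs ?_).2
  · exact Eventually.of_forall fun t => by fun_prop
  · refine ae_of_all _ fun u x _ => ?_
    rw [norm_mul, ← Complex.ofReal_mul, Complex.norm_exp_ofReal_mul_I]
    simp
  · refine ae_of_all _ fun u x _ => ?_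
    have h1 : HasDerivAt (fun x : ℝ => (x : ℂ) * u * Complex.I) (u * Complex.I) x := by
      have := ((Complex.ofRealCLM.hasDerivAt (x := x)).mul_const (u : ℂ)).mul_const Complex.I
      simpa using this
    exact (h1.cexp).sub_const 1

/-- derivative of a char function -/
lemma charFun_deriv (P : Measure ℝ) [IsFiniteMeasure P] (h : Integrable (fun u : ℝ => u) P) (t : ℝ) :
    HasDerivAt (charFun P) (∫ u : ℝ, Complex.exp (t * u * Complex.I) * (u * Complex.I) ∂P) t := by
  have := (psi_deriv P h t).add_const (P.real univ : ℂ)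
  refine this.congr_of_eventuallyEq (Eventually.of_forall fun (s : ℝ) => ?_)
  have hI : Integrable (fun x : ℝ => Complex.exp (s * x * Complex.I)) P := by
    refine Integrable.of_bound (by fun_prop) 1 (ae_of_all _ fun x => ?_)
    rw [← Complex.ofReal_mul, Complex.norm_exp_ofReal_mul_I]
  simp only [psi]
  rw [integral_sub hI (integrable_const _), charFun_apply_real]
  simp

lemma charFun_cpois' (ν : Measure ℝ) [IsFiniteMeasure ν] (t : ℝ) :
    charFun (cpois ν) t = Complex.exp (psi ν t) := by
  have hI : Integrable (fun x : ℝ => Complex.exp (t * x * Complex.I)) ν := by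
    refine Integrable.of_bound (by fun_prop) 1 (ae_of_all _ fun x => ?_)
    rw [← Complex.ofReal_mul, Complex.norm_exp_ofReal_mul_I]
  rw [charFun_cpois, psi, integral_sub hI (integrable_const _), charFun_apply_real]
  simp

/-- existence of the infinitely divisible law of bounded variation -/
lemma exists_law (ν : Measure ℝ) (h : Integrable (fun u : ℝ => u) ν) :
    ∃ Q : Measure ℝ, IsProbabilityMeasure Q ∧ (∀ t, charFun Q t = Complex.exp (psi ν t)) ∧
      ∫⁻ x, ‖x‖ₑ ∂Q ≤ ∫⁻ u, ‖u‖ₑ ∂ν := by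
  let S : ℕ → Set ℝ := fun n => {u | 1 / ((n : ℝ) + 1) ≤ ‖u‖}
  have hSm : ∀ n, MeasurableSet (S n) := fun n => measurableSet_le measurable_const measurable_norm
  have hSfin : ∀ n, ν (S n) < ⊤ := fun n => h.measure_norm_ge_lt_top (by positivity)
  have hfin : ∀ n, IsFiniteMeasure (ν.restrict (S n)) := fun n => ⟨by simpa using hSfin n⟩
  have hmono : Monotone S := by
    intro m n hmn u hu
    have hu' : 1 / ((m : ℝ) + 1) ≤ ‖u‖ := hu
    refine le_trans ?_ hu'
    gcongr
  have hU : ∀ t : ℝ, ∫ u in ⋃ n, S n, (Complex.exp (t * u * Complex.I) - 1) ∂ν = psi ν t := by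
    intro t
    refine setIntegral_eq_integral_of_forall_compl_eq_zero fun u hu => ?_
    have : u = 0 := by
      by_contra hne
      apply hu
      obtain ⟨n, hn⟩ := exists_nat_one_div_lt (norm_pos_iff.2 hne)
      exact mem_iUnion.2 ⟨n, hn.le⟩
    simp [this]
  let p : ℕ → ProbabilityMeasure ℝ := fun n => ⟨cpois (ν.restrict (S n)), inferInstance⟩
  have hlim : ∀ t : ℝ, Tendsto (fun n => charFun (p n : Measure ℝ) t) atTop (𝓝 (Complex.exp (psi ν t))) := by
    intro t
    have h1 := tendsto_setIntegral_of_monotone hSm hmono (int1 ν h t).integrableOn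
    rw [hU] at h1
    refine ((Complex.continuous_exp.tendsto _).comp h1).congr fun n => ?_
    exact (charFun_cpois' _ t).symm
  have hcont : ContinuousAt (fun t => Complex.exp (psi ν t)) 0 :=
    (psi_deriv ν h 0).continuousAt.cexp
  have ht : IsTightMeasureSet (Set.range fun n => (p n : Measure ℝ)) :=
    isTightMeasureSet_of_tendsto_charFun hcont hlim
  have hc : IsCompact (closure (range p)) := by
    refine isCompact_closure_of_isTightMeasureSet ?_
    convert ht using 1
    ext m; simp
  obtain ⟨Q, -, φ, hφ, hQ⟩ := hc.isSeqCompact (x := p) (fun n => subset_closure (mem_range_self n))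
  refine ⟨Q, inferInstance, fun t => ?_, ?_⟩
  · have := (ProbabilityMeasure.tendsto_iff_tendsto_charFun.1 hQ) t
    exact tendsto_nhds_unique this ((hlim t).comp hφ.tendsto_atTop)
  · have hl := lintegral_le_liminf_lintegral_of_forall_isOpen_measure_le_liminf_measure
      (μ := (Q : Measure ℝ)) (μs := fun n => ((p (φ n) : ProbabilityMeasure ℝ) : Measure ℝ))
      (f := fun x : ℝ => |x|) continuous_abs (fun x => abs_nonneg x)
      (fun G hG => ProbabilityMeasure.le_liminf_measure_open_of_tendsto hQ hG)
    simp only [← Real.enorm_eq_ofReal_abs] at hl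
    refine hl.trans ?_
    refine (liminf_le_liminf (v := fun _ => ∫⁻ u, ‖u‖ₑ ∂ν) (Eventually.of_forall fun n => ?_)).trans ?_
    · exact (lintegral_cpois _).trans (lintegral_mono' Measure.restrict_le_self le_rfl)
    · simp

lemma int_exp (P : Measure ℝ) [IsFiniteMeasure P] (t : ℝ) :
    Integrable (fun x : ℝ => Complex.exp (t * x * Complex.I)) P := by
  refine Integrable.of_bound (by fun_prop) 1 (ae_of_all _ fun x => ?_)
  rw [← Complex.ofReal_mul, Complex.norm_exp_ofReal_mul_I]

lemma charFun_add' (P Q : Measure ℝ) [IsFiniteMeasure P] [IsFiniteMeasure Q] (t : ℝ) :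
    charFun (P + Q) t = charFun P t + charFun Q t := by
  simp only [charFun_apply_real]
  exact integral_add_measure (int_exp P t) (int_exp Q t)

/-- positive part density measure -/
noncomputable def kp (m : Measure ℝ) : Measure ℝ := m.withDensity fun u => ENNReal.ofReal u
/-- negative part density measure -/
noncomputable def km (m : Measure ℝ) : Measure ℝ := m.withDensity fun u => ENNReal.ofReal (-u)

lemma kp_fin (m : Measure ℝ) (h : Integrable (fun u : ℝ => u) m) : IsFiniteMeasure (kp m) :=
  isFiniteMeasure_withDensity_ofReal h.2
lemma km_fin (m : Measure ℝ) (h : Integrable (fun u : ℝ => u) m) : IsFiniteMeasure (km m) :=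
  isFiniteMeasure_withDensity_ofReal h.neg.2

lemma cf_sub (m : Measure ℝ) (h : Integrable (fun u : ℝ => u) m) (t : ℝ) :
    (charFun (kp m) t - charFun (km m) t) * Complex.I =
      ∫ u : ℝ, Complex.exp (t * u * Complex.I) * (u * Complex.I) ∂m := by
  have hb : ∀ f : ℝ → ℝ, Measurable f → (∀ u, |f u| ≤ |u|) →
      Integrable (fun u : ℝ => f u • Complex.exp (t * u * Complex.I)) m := by
    intro f hf hfu
    refine Integrable.mono' h.abs (by fun_prop) (ae_of_all _ fun u => ?_)
    rw [norm_smul, ← Complex.ofReal_mul, Complex.norm_exp_ofReal_mul_I, mul_one]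
    exact hfu u
  rw [charFun_apply_real, charFun_apply_real, kp, km,
    integral_withDensity_eq_integral_toReal_smul (by fun_prop) (by simp),
    integral_withDensity_eq_integral_toReal_smul (by fun_prop) (by simp),
    ← integral_sub, ← integral_mul_const]
  · congr 1; ext u
    rw [← sub_smul, Complex.real_smul]
    have : (ENNReal.ofReal u).toReal - (ENNReal.ofReal (-u)).toReal = u := by
      rw [ENNReal.toReal_ofReal', ENNReal.toReal_ofReal']
      rcases le_total 0 u with hu | hu
      · rw [max_eq_left hu, max_eq_right (by linarith)]; ring
      · rw [max_eq_right hu, max_eq_left (by linarith)]; ring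
    rw [this]; ring
  · refine hb _ (by fun_prop) fun u => ?_
    rw [ENNReal.toReal_ofReal', abs_of_nonneg (le_max_right _ _)]
    exact max_le (le_abs_self u) (abs_nonneg u)
  · refine hb _ (by fun_prop) fun u => ?_
    rw [ENNReal.toReal_ofReal', abs_of_nonneg (le_max_right _ _)]
    exact max_le (neg_le_abs u) (abs_nonneg u)

lemma law_int (ν : Measure ℝ) (h : Integrable (fun u : ℝ => u) ν)
    (P : Measure ℝ) [IsProbabilityMeasure P] (hP : ∀ t, charFun P t = Complex.exp (psi ν t)) :
    Integrable (fun x : ℝ => x) P := by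
  obtain ⟨Q, hQ, hQc, hQi⟩ := exists_law ν h
  have : P = Q := Measure.ext_of_charFun (by ext t; rw [hP, hQc])
  subst this
  exact ⟨by fun_prop, hQi.trans_lt h.2⟩

lemma measure_identity (ν : Measure ℝ) (h : Integrable (fun u : ℝ => u) ν)
    (P : Measure ℝ) [IsProbabilityMeasure P] (hP : ∀ t, charFun P t = Complex.exp (psi ν t)) :
    kp P + P ∗ km ν = km P + P ∗ kp ν := by
  have hPi := law_int ν h P hP
  have := kp_fin _ h
  have := km_fin _ h
  have := kp_fin _ hPi
  have := km_fin _ hPi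
  refine Measure.ext_of_charFun ?_
  ext t
  rw [charFun_add', charFun_add', charFun_conv, charFun_conv]
  have h1 := charFun_deriv P hPi t
  have h2 := (psi_deriv ν h t).cexp
  rw [show charFun P = fun t => Complex.exp (psi ν t) from funext hP] at h1
  have h3 := h1.unique h2
  rw [← cf_sub P hPi, ← cf_sub ν h, ← hP, ← mul_assoc] at h3
  have h4 := mul_right_cancel₀ Complex.I_ne_zero h3
  linear_combination h4

lemma lintegral_identity (ν : Measure ℝ) (h : Integrable (fun u : ℝ => u) ν)
    (P : Measure ℝ) [IsProbabilityMeasure P] (hP : ∀ t, charFun P t = Complex.exp (psi ν t))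
    (f : ℝ → ℝ≥0∞) (hf : Measurable f) :
    ∫⁻ x, ENNReal.ofReal x * f x ∂P + ∫⁻ x, ∫⁻ u, f (x + u) ∂(km ν) ∂P =
    ∫⁻ x, ENNReal.ofReal (-x) * f x ∂P + ∫⁻ x, ∫⁻ u, f (x + u) ∂(kp ν) ∂P := by
  have := kp_fin _ h
  have := km_fin _ h
  have hid := congrArg (fun m => ∫⁻ x, f x ∂m) (measure_identity ν h P hP)
  simp only [lintegral_add_measure] at hid
  rw [Measure.lintegral_conv hf, Measure.lintegral_conv hf] at hid
  rw [show kp P = P.withDensity fun u => ENNReal.ofReal u from rfl,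
    show km P = P.withDensity fun u => ENNReal.ofReal (-u) from rfl,
    lintegral_withDensity_eq_lintegral_mul _ (by fun_prop) hf,
    lintegral_withDensity_eq_lintegral_mul _ (by fun_prop) hf] at hid
  exact hid

lemma finite_big (ν : Measure ℝ) (h : Integrable (fun u : ℝ => u) ν)
    (P : Measure ℝ) [IsProbabilityMeasure P] (hP : ∀ t, charFun P t = Complex.exp (psi ν t))
    (g : ℝ → ℝ≥0∞) (hg : Measurable g) (hgP : ∫⁻ x, g x ∂P ≠ ⊤) :
    ∀ᵐ x ∂P, ∫⁻ u in {u : ℝ | 1 ≤ ‖u‖}, g (x + u) ∂ν < ⊤ := by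
  set S : Set ℝ := {u : ℝ | 1 ≤ ‖u‖} with hS
  have hSm : MeasurableSet S := measurableSet_le measurable_const measurable_norm
  have hfin : IsFiniteMeasure (ν.restrict S) :=
    ⟨by rw [Measure.restrict_apply_univ]; exact h.measure_norm_ge_lt_top one_pos⟩
  obtain ⟨Q, hQ, hQc, -⟩ := exists_law (ν.restrict Sᶜ) h.integrableOn
  have hPQ : P = cpois (ν.restrict S) ∗ Q := by
    refine Measure.ext_of_charFun ?_
    ext t
    rw [charFun_conv, hP, hQc, charFun_cpois', ← Complex.exp_add, psi, psi, psi,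
      integral_add_compl hSm (int1 ν h t)]
  have hsum : ∀ f : ℝ → ℝ≥0∞, Measurable f → ∫⁻ x, f x ∂P = ∑' n : ℕ,
      ENNReal.ofReal (Real.exp (-((ν.restrict S).real univ)) / n.factorial) *
        ∫⁻ x, f x ∂(cpow (ν.restrict S) n ∗ Q) := by
    intro f hf
    rw [hPQ, Measure.lintegral_conv hf, cpois, lintegral_sum_measure]
    simp only [lintegral_smul_measure, smul_eq_mul]
    congr 1; ext n
    rw [Measure.lintegral_conv hf]
  have hFm : Measurable fun x => ∫⁻ u in S, g (x + u) ∂ν := by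
    have : Measurable (fun p : ℝ × ℝ => g (p.1 + p.2)) := by fun_prop
    exact this.lintegral_prod_right'
  have hD : MeasurableSet {x | ¬ (∫⁻ u in S, g (x + u) ∂ν < ⊤)} :=
    (measurableSet_lt hFm measurable_const).compl
  rw [ae_iff, ← lintegral_indicator_one hD, hsum _ (measurable_one.indicator hD),
    ENNReal.tsum_eq_zero]
  intro n
  rw [lintegral_indicator_one hD]
  refine mul_eq_zero_of_right _ (ae_iff.1 ?_)
  refine ae_lt_top hFm ?_
  rw [← Measure.lintegral_conv hg]
  have hc : (cpow (ν.restrict S) n ∗ Q) ∗ ν.restrict S = cpow (ν.restrict S) (n + 1) ∗ Q := by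
    rw [Measure.conv_comm, cpow, Measure.conv_assoc]
  rw [hc]
  rw [hsum g hg] at hgP
  have h1 := ENNReal.ne_top_of_tsum_ne_top hgP (n + 1)
  intro htop
  rw [htop, ENNReal.mul_top] at h1
  · exact h1 rfl
  · rw [Ne, ENNReal.ofReal_eq_zero, not_le]; positivity

lemma finite_all (ν : Measure ℝ) (h : Integrable (fun u : ℝ => u) ν)
    (P : Measure ℝ) [IsProbabilityMeasure P] (hP : ∀ t, charFun P t = Complex.exp (psi ν t))
    (w : ℝ → ℝ) (hw : Continuous w) 
    (h1 : Integrable w P) (h2 : Integrable (fun x => x * w x) P) :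
    ∀ᵐ x ∂P, Integrable (fun u => w (x + u) * u) ν := by
  have hb := finite_big ν h P hP (fun x => ‖w x‖ₑ + ‖x * w x‖ₑ) (by fun_prop) (by
    rw [lintegral_add_left (by fun_prop)]
    exact ENNReal.add_ne_top.2 ⟨h1.2.ne, h2.2.ne⟩)
  filter_upwards [hb] with x hx
  set S : Set ℝ := {u : ℝ | 1 ≤ ‖u‖} with hS
  have hSm : MeasurableSet S := measurableSet_le measurable_const measurable_norm
  rw [← integrableOn_univ, ← union_compl_self S]
  refine IntegrableOn.union ⟨by fun_prop, ?_⟩ ?_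
  · refine lt_of_le_of_lt ?_ (ENNReal.mul_lt_top (a := 1 + ‖x‖ₑ) (by simp) hx)
    rw [← lintegral_const_mul _ (by fun_prop)]
    refine lintegral_mono fun u => ?_
    have hu : ‖u‖ₑ ≤ ‖x + u‖ₑ + ‖x‖ₑ := by
      have := enorm_sub_le (a := x + u) (b := x)
      simpa using this
    simp only [enorm_mul]
    calc ‖w (x + u)‖ₑ * ‖u‖ₑ ≤ ‖w (x + u)‖ₑ * (‖x + u‖ₑ + ‖x‖ₑ) := by gcongr
      _ ≤ ‖w (x + u)‖ₑ * (‖x + u‖ₑ + ‖x‖ₑ) + (‖w (x + u)‖ₑ + ‖x‖ₑ * (‖x + u‖ₑ * ‖w (x + u)‖ₑ)) :=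
        le_self_add
      _ = _ := by ring
  · obtain ⟨M, hM⟩ := (isCompact_closedBall x 1).exists_bound_of_continuousOn hw.continuousOn
    refine Integrable.mono' (h.abs.const_mul M).integrableOn (by fun_prop) ?_
    rw [ae_restrict_iff' hSm.compl]
    refine ae_of_all _ fun u hu => ?_
    rw [norm_mul]
    have hu' : ‖u‖ < 1 := not_le.1 hu
    have := hM (x + u) (by simpa using hu'.le)
    rw [← Real.norm_eq_abs u]
    gcongr

end WP

theorem weighted_premium_IDD
    {Ω : Type*} [MeasureSpace Ω] [IsProbabilityMeasure (ℙ : Measure Ω)]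
    (X : Ω → ℝ) (hX : Measurable X)
    (μ : ℝ) (ν : Measure ℝ)
    (hν0 : ν {0} = 0)
    (hνfin : ∫⁻ u : ℝ, ENNReal.ofReal (min 1 (u ^ 2)) ∂ν < ⊤)
    -- X ~ IDD(μ, 0, ν)
    (hcf : ∀ t : ℝ,
      ∫ ω, Complex.exp (Complex.I * t * X ω) ∂ℙ
        = Complex.exp (Complex.I * t * μ
            + ∫ u : ℝ, (Complex.exp (Complex.I * t * u) - 1 - Complex.I * t * u) ∂ν))
    -- μ = ∫ u ν(du) < ∞, so that E[X] = μ
    (hν1 : Integrable (fun u : ℝ => u) ν)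
    (hμ : μ = ∫ u : ℝ, u ∂ν)
    -- w is a nonnegative absolutely continuous weight function with derivative w'
    (w w' : ℝ → ℝ)
    (hwnonneg : ∀ x, 0 ≤ w x)
    (hw'loc : LocallyIntegrable w' volume)
    (hw : ∀ x : ℝ, w x = w 0 + ∫ t in (0:ℝ)..x, w' t)
    -- 0 < E[w(X)] < ∞, E[|X w(X)|] < ∞, E[∫ |w(X+u) u| ν(du)] < ∞
    (hwX : Integrable (fun ω => w (X ω)) ℙ)
    (hwXpos : 0 < ∫ ω, w (X ω) ∂ℙ)
    (hXwX : Integrable (fun ω => X ω * w (X ω)) ℙ)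
    (hint : Integrable (fun ω => ∫ u : ℝ, |w (X ω + u) * u| ∂ν) ℙ) :
    (∫ ω, X ω * w (X ω) ∂ℙ) = (∫ ω, (∫ u : ℝ, w (X ω + u) * u ∂ν) ∂ℙ)
      ∧ (∫ ω, X ω * w (X ω) ∂ℙ) / (∫ ω, w (X ω) ∂ℙ)
          = (∫ ω, (∫ u : ℝ, w (X ω + u) * u ∂ν) ∂ℙ) / (∫ ω, w (X ω) ∂ℙ) := by
  suffices hmain : (∫ ω, X ω * w (X ω) ∂ℙ) = (∫ ω, (∫ u : ℝ, w (X ω + u) * u ∂ν) ∂ℙ) from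
    ⟨hmain, by rw [hmain]⟩
  have hwc : Continuous w := by
    rw [show w = fun x => w 0 + ∫ t in (0:ℝ)..x, w' t from funext hw]
    exact continuous_const.add (intervalIntegral.continuous_primitive
      (fun a b => (hw'loc.integrableOn_isCompact isCompact_uIcc).intervalIntegrable) 0)
  set P : Measure ℝ := Measure.map X ℙ with hPdef
  have hPp : IsProbabilityMeasure P := Measure.isProbabilityMeasure_map hX.aemeasurable
  have hP : ∀ t, charFun P t = Complex.exp (WP.psi ν t) := by
    intro t
    rw [charFun_apply_real, hPdef, integral_map hX.aemeasurable (by fun_prop)]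
    have h1 := hcf t
    have e1 : ∀ x : ℝ, Complex.I * t * x = t * x * Complex.I := fun x => by ring
    simp only [e1] at h1
    rw [h1]
    congr 1
    have hi : Integrable (fun u : ℝ => (t * u * Complex.I : ℂ)) ν :=
      (hν1.ofReal.const_mul (t : ℂ)).mul_const _
    rw [integral_sub (WP.int1 ν hν1 t) hi, integral_mul_const, integral_const_mul,
      integral_complex_ofReal, ← hμ, WP.psi]
    ring
  have hwP : Integrable w P :=
    (integrable_map_measure hwc.aestronglyMeasurable hX.aemeasurable).2 hwX
  have hxwP : Integrable (fun x => x * w x) P :=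
    (integrable_map_measure (by fun_prop) hX.aemeasurable).2 hXwX
  have hkp := WP.kp_fin _ hν1
  have hkm := WP.km_fin _ hν1
  let f : ℝ → ℝ≥0∞ := fun x => ENNReal.ofReal (w x)
  have hf : Measurable f := by fun_prop
  let c : ℝ → ℝ≥0∞ := fun x => ∫⁻ u, f (x + u) ∂(WP.kp ν)
  let d : ℝ → ℝ≥0∞ := fun x => ∫⁻ u, f (x + u) ∂(WP.km ν)
  have hfm : Measurable (fun p : ℝ × ℝ => f (p.1 + p.2)) := by fun_prop
  have hc : Measurable c := hfm.lintegral_prod_right'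
  have hd : Measurable d := hfm.lintegral_prod_right'
  have hc' : ∀ x, c x = ∫⁻ u, ENNReal.ofReal (w (x + u) * u) ∂ν := by
    intro x
    simp only [c, WP.kp]
    rw [lintegral_withDensity_eq_lintegral_mul _ (by fun_prop) (by fun_prop)]
    congr 1; ext u
    simp only [Pi.mul_apply, f]
    rw [ENNReal.ofReal_mul (hwnonneg _), mul_comm]
  have hd' : ∀ x, d x = ∫⁻ u, ENNReal.ofReal (-(w (x + u) * u)) ∂ν := by
    intro x
    simp only [d, WP.km]
    rw [lintegral_withDensity_eq_lintegral_mul _ (by fun_prop) (by fun_prop)]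
    congr 1; ext u
    simp only [Pi.mul_apply, f]
    rw [← mul_neg, ENNReal.ofReal_mul (hwnonneg _), mul_comm]
  have hae : ∀ᵐ ω ∂(ℙ : Measure Ω), Integrable (fun u => w (X ω + u) * u) ν :=
    ae_of_ae_map hX.aemeasurable (WP.finite_all ν hν1 P hP w hwc hwP hxwP)
  have hFtop : ∫⁻ ω, ENNReal.ofReal (∫ u : ℝ, |w (X ω + u) * u| ∂ν) ∂ℙ < ⊤ :=
    hint.lintegral_lt_top
  have hcle : ∫⁻ ω, c (X ω) ∂ℙ < ⊤ := by
    refine lt_of_le_of_lt (lintegral_mono_ae ?_) hFtop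
    filter_upwards [hae] with ω hω
    rw [hc', ofReal_integral_eq_lintegral_ofReal hω.abs (ae_of_all _ fun u => abs_nonneg _)]
    exact lintegral_mono fun u => ENNReal.ofReal_le_ofReal (le_abs_self _)
  have hdle : ∫⁻ ω, d (X ω) ∂ℙ < ⊤ := by
    refine lt_of_le_of_lt (lintegral_mono_ae ?_) hFtop
    filter_upwards [hae] with ω hω
    rw [hd', ofReal_integral_eq_lintegral_ofReal hω.abs (ae_of_all _ fun u => abs_nonneg _)]
    exact lintegral_mono fun u => ENNReal.ofReal_le_ofReal (neg_le_abs _)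
  have hR : (∫ ω, (∫ u : ℝ, w (X ω + u) * u ∂ν) ∂ℙ) =
      (∫⁻ ω, c (X ω) ∂ℙ).toReal - (∫⁻ ω, d (X ω) ∂ℙ).toReal := by
    have hcX : AEMeasurable (fun ω => c (X ω)) ℙ := (hc.comp hX).aemeasurable
    have hdX : AEMeasurable (fun ω => d (X ω)) ℙ := (hd.comp hX).aemeasurable
    rw [← integral_toReal hcX (ae_lt_top' hcX hcle.ne),
      ← integral_toReal hdX (ae_lt_top' hdX hdle.ne),
      ← integral_sub (integrable_toReal_of_lintegral_ne_top hcX hcle.ne)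
        (integrable_toReal_of_lintegral_ne_top hdX hdle.ne)]
    refine integral_congr_ae ?_
    filter_upwards [hae] with ω hω
    rw [integral_eq_lintegral_pos_part_sub_lintegral_neg_part hω, hc', hd']
  have hL := integral_eq_lintegral_pos_part_sub_lintegral_neg_part hXwX
  have hA : ∫⁻ ω, ENNReal.ofReal (X ω * w (X ω)) ∂ℙ = ∫⁻ x, ENNReal.ofReal x * f x ∂P := by
    rw [hPdef, lintegral_map (by fun_prop) hX]
    congr 1; ext ω
    rw [ENNReal.ofReal_mul' (hwnonneg _)]
  have hB : ∫⁻ ω, ENNReal.ofReal (-(X ω * w (X ω))) ∂ℙ = ∫⁻ x, ENNReal.ofReal (-x) * f x ∂P := by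
    rw [hPdef, lintegral_map (by fun_prop) hX]
    congr 1; ext ω
    rw [← neg_mul, ENNReal.ofReal_mul' (hwnonneg _)]
  have hAt := hXwX.lintegral_lt_top
  have hBt := hXwX.neg.lintegral_lt_top
  simp only [Pi.neg_apply] at hBt
  have hid := WP.lintegral_identity ν hν1 P hP f hf
  have hCx : ∫⁻ x, ∫⁻ u, f (x + u) ∂(WP.kp ν) ∂P = ∫⁻ ω, c (X ω) ∂ℙ := by
    rw [hPdef, lintegral_map hc hX]
  have hDx : ∫⁻ x, ∫⁻ u, f (x + u) ∂(WP.km ν) ∂P = ∫⁻ ω, d (X ω) ∂ℙ := by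
    rw [hPdef, lintegral_map hd hX]
  rw [hCx, hDx, ← hA, ← hB] at hid
  have hid2 := congrArg ENNReal.toReal hid
  rw [ENNReal.toReal_add hAt.ne hdle.ne, ENNReal.toReal_add hBt.ne hcle.ne] at hid2
  rw [hL, hR]
  linarith
end

section
/- Let X be a random variable with the CGMY(α, β, λ⁺, λ⁻) distribution, i.e. E[exp(itX)] = exp( ∫_ℝ (exp(itu) − 1) ν_cgmy(du) ) for all t ∈ ℝ, where ν_cgmy(du) = ( α u^{−1−β} e^{−λ⁺u} 1_{(0,∞)}(u) + α |u|^{−1−β} e^{−λ⁻|u|} 1_{(−∞,0)}(u) ) du with α, λ⁺, λ⁻ > 0 and β ∈ [0,1). Then for every 0 < κ < λ⁺ the Esscher premium satisfies E[X e^{κX}] / E[e^{κX}] = α Γ(1−β)/(λ⁺ − κ)^{1−β} − α Γ(1−β)/(λ⁻ + κ)^{1−β}. -/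
open MeasureTheory ProbabilityTheory Set

open Filter Topology

lemma cg_exp_sub_one (w : ℂ) : ‖Complex.exp w - 1‖ ≤ ‖w‖ * (1 + Real.exp w.re) := by
  have h := Convex.norm_image_sub_le_of_norm_hasDerivWithin_le (𝕜 := ℂ)
    (f := Complex.exp) (f' := Complex.exp) (s := {z : ℂ | z.re ≤ max 0 w.re})
    (C := 1 + Real.exp w.re) (x := 0) (y := w)
    (fun x _ => (Complex.hasDerivAt_exp x).hasDerivWithinAt)
    (fun x hx => by
      rw [Complex.norm_exp]
      refine (Real.exp_le_exp.2 hx).trans ?_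
      rcases max_cases 0 w.re with ⟨h, _⟩ | ⟨h, _⟩ <;> rw [h]
      · simp [Real.exp_nonneg]
      · simp)
    (convex_halfSpace_re_le _) (by simp) (by simp)
  simpa [mul_comm] using h

lemma cg_exp_mid {a x b u : ℝ} (h1 : a ≤ x) (h2 : x ≤ b) :
    Real.exp (x * u) ≤ Real.exp (a * u) + Real.exp (b * u) := by
  rcases le_total 0 u with hu | hu
  · have : Real.exp (x * u) ≤ Real.exp (b * u) := Real.exp_le_exp.2 (by nlinarith)
    linarith [Real.exp_nonneg (a * u)]
  · have : Real.exp (x * u) ≤ Real.exp (a * u) := Real.exp_le_exp.2 (by nlinarith)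
    linarith [Real.exp_nonneg (b * u)]

lemma cg_int {ν : Measure ℝ} {a b : ℝ} (ha : a < 0) (hb : 0 < b)
    (hint : ∀ x ∈ Ioo a b, Integrable (fun u => |u| * Real.exp (x * u)) ν)
    {z : ℂ} (hz : z.re ∈ Ioo a b) :
    Integrable (fun u : ℝ => Complex.exp (z * u) - 1) ν := by
  have h0 := hint 0 ⟨ha, hb⟩
  refine (((h0.add (hint _ hz)).const_mul ‖z‖)).mono' ?_ ?_
  · exact (Continuous.aestronglyMeasurable (by fun_prop))
  · refine ae_of_all _ fun u => (cg_exp_sub_one _).trans (le_of_eq ?_)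
    simp [Complex.mul_re]
    ring

lemma cg_deriv {ν : Measure ℝ} {a b : ℝ} (ha : a < 0) (hb : 0 < b)
    (hint : ∀ x ∈ Ioo a b, Integrable (fun u => |u| * Real.exp (x * u)) ν)
    {z : ℂ} (hz : z.re ∈ Ioo a b) :
    HasDerivAt (fun z : ℂ => ∫ u : ℝ, (Complex.exp (z * u) - 1) ∂ν)
      (∫ u : ℝ, (u : ℂ) * Complex.exp (z * u) ∂ν) z := by
  obtain ⟨a', ha1, ha2⟩ := exists_between hz.1
  obtain ⟨b', hb1, hb2⟩ := exists_between hz.2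
  have A := hint a' ⟨ha1, by linarith⟩
  have B := hint b' ⟨by linarith, hb2⟩
  refine (hasDerivAt_integral_of_dominated_loc_of_deriv_le
    (s := {w : ℂ | w.re ∈ Ioo a' b'}) (F' := fun z u => (u : ℂ) * Complex.exp (z * u))
    (bound := fun u => |u| * Real.exp (a' * u) + |u| * Real.exp (b' * u)) ?_ ?_ ?_ ?_ ?_ ?_ ?_).2
  · exact (isOpen_Ioo.preimage Complex.continuous_re).mem_nhds ⟨ha2, hb1⟩
  · exact Eventually.of_forall fun w => Continuous.aestronglyMeasurable (by fun_prop)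
  · exact cg_int ha hb hint hz
  · exact Continuous.aestronglyMeasurable (by fun_prop)
  · refine ae_of_all _ fun u w hw => ?_
    have := cg_exp_mid (u := u) hw.1.le hw.2.le
    simp only [norm_mul, Complex.norm_real, Complex.norm_exp, Real.norm_eq_abs]
    simp only [Complex.mul_re, Complex.ofReal_re, Complex.ofReal_im, mul_zero, sub_zero]
    nlinarith [abs_nonneg u]
  · exact A.add B
  · refine ae_of_all _ fun u w hw => ?_
    have h := (((hasDerivAt_id w).mul_const (u : ℂ)).cexp).sub_const 1
    simpa [mul_comm] using h

lemma cg_re_le {ν : Measure ℝ} {a b : ℝ} (ha : a < 0) (hb : 0 < b)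
    (hint : ∀ x ∈ Ioo a b, Integrable (fun u => |u| * Real.exp (x * u)) ν)
    {z : ℂ} (hz : z.re ∈ Ioo a b) :
    (∫ u : ℝ, (Complex.exp (z * u) - 1) ∂ν).re ≤
      (∫ u : ℝ, (Complex.exp ((z.re : ℂ) * u) - 1) ∂ν).re := by
  have h1 := cg_int ha hb hint hz
  have h2 := cg_int ha hb hint (z := (z.re : ℂ)) (by simpa using hz)
  have e1 := integral_re h1
  have e2 := integral_re h2
  simp only [RCLike.re_to_complex] at e1 e2
  rw [← e1, ← e2]
  refine integral_mono h1.re h2.re fun u => ?_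
  simp only [Complex.sub_re, Complex.one_re]
  have : (Complex.exp ((z.re : ℂ) * u)).re = Real.exp (z.re * u) := by
    rw [← Complex.ofReal_mul, ← Complex.ofReal_exp, Complex.ofReal_re]
  rw [this]
  have h3 := Complex.re_le_norm (Complex.exp (z * u))
  rw [Complex.norm_exp] at h3
  simp [Complex.mul_re] at h3
  linarith

lemma cg_H_diff {ν : Measure ℝ} {a b : ℝ} (ha : a < 0) (hb : 0 < b)
    (hint : ∀ x ∈ Ioo a b, Integrable (fun u => |u| * Real.exp (x * u)) ν)
    (P : Measure ℝ) [IsProbabilityMeasure P]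
    {z : ℂ} (hz : z.re ∈ Ioo a b) :
    DifferentiableAt ℂ (fun z : ℂ => ∫ s : ℝ, Complex.exp
      (∫ u : ℝ, (Complex.exp ((z + Complex.I * s) * u) - 1) ∂ν) ∂P) z := by
  obtain ⟨a', ha1, ha2⟩ := exists_between hz.1
  obtain ⟨b', hb1, hb2⟩ := exists_between hz.2
  have A := hint a' ⟨ha1, by linarith⟩
  have B := hint b' ⟨by linarith, hb2⟩
  set ψ : ℂ → ℂ := fun z => ∫ u : ℝ, (Complex.exp (z * u) - 1) ∂ν with hψ
  set ψ' : ℂ → ℂ := fun z => ∫ u : ℝ, (u : ℂ) * Complex.exp (z * u) ∂ν with hψ'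
  have hd : ∀ w : ℂ, w.re ∈ Ioo a b → HasDerivAt ψ (ψ' w) w := fun w hw => cg_deriv ha hb hint hw
  have hsub : ∀ w : ℂ, w.re ∈ Ioo a' b' → w.re ∈ Ioo a b := fun w hw =>
    ⟨ha1.trans hw.1, hw.2.trans hb2⟩
  -- bound for ψ on reals
  obtain ⟨K, hK⟩ := (isCompact_Icc (a := a') (b := b')).exists_bound_of_continuousOn
    (f := fun x : ℝ => ψ x) (fun x hx => by
      have := (hd (x : ℂ) ⟨by simpa using ha1.trans_le hx.1, by simpa using hx.2.trans_lt hb2⟩)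
      exact (this.continuousAt.comp Complex.continuous_ofReal.continuousAt).continuousWithinAt)
  have hF : ∀ w : ℂ, w.re ∈ Ioo a' b' → ‖Complex.exp (ψ w)‖ ≤ Real.exp K := by
    intro w hw
    rw [Complex.norm_exp, Real.exp_le_exp]
    refine (cg_re_le ha hb hint (hsub w hw)).trans ((Complex.re_le_norm _).trans ?_)
    exact hK w.re ⟨hw.1.le, hw.2.le⟩
  set D : ℝ := ∫ u : ℝ, (|u| * Real.exp (a' * u) + |u| * Real.exp (b' * u)) ∂ν
  have hψb : ∀ w : ℂ, w.re ∈ Ioo a' b' → ‖ψ' w‖ ≤ D := by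
    intro w hw
    refine norm_integral_le_of_norm_le (A.add B) (ae_of_all _ fun u => ?_)
    have := cg_exp_mid (u := u) hw.1.le hw.2.le
    simp only [norm_mul, Complex.norm_real, Complex.norm_exp, Real.norm_eq_abs]
    simp only [Complex.mul_re, Complex.ofReal_re, Complex.ofReal_im, mul_zero, sub_zero]
    nlinarith [abs_nonneg u]
  have hopen : IsOpen {w : ℂ | w.re ∈ Ioo a' b'} := isOpen_Ioo.preimage Complex.continuous_re
  have hre : ∀ (w : ℂ) (s : ℝ), (w + Complex.I * s).re = w.re := by intro w s; simp
  have hd2 : ∀ w : ℂ, w.re ∈ Ioo a' b' →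
      HasDerivAt (fun w => Complex.exp (ψ w)) (Complex.exp (ψ w) * ψ' w) w :=
    fun w hw => (hd w (hsub w hw)).cexp
  have hcont : ∀ w : ℂ, w.re ∈ Ioo a' b' →
      Continuous fun s : ℝ => Complex.exp (ψ (w + Complex.I * s)) := by
    intro w hw
    refine continuous_iff_continuousAt.2 fun s => ?_
    have h1 := (hd2 (w + Complex.I * s) (by rw [hre]; exact hw)).continuousAt
    exact ContinuousAt.comp (f := fun s : ℝ => w + Complex.I * s) h1 (by fun_prop)
  have hcont' : Continuous fun s : ℝ => deriv (fun w => Complex.exp (ψ w)) (z + Complex.I * s) := by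
    refine continuous_iff_continuousAt.2 fun s => ?_
    have hdo : DifferentiableOn ℂ (fun w => Complex.exp (ψ w)) {w : ℂ | w.re ∈ Ioo a' b'} :=
      fun w hw => (hd2 w hw).differentiableAt.differentiableWithinAt
    have h1 := ((hdo.deriv hopen).differentiableAt
      (hopen.mem_nhds (show (z + Complex.I * s).re ∈ Ioo a' b' by
        rw [hre]; exact ⟨ha2, hb1⟩))).continuousAt
    exact ContinuousAt.comp (f := fun s : ℝ => z + Complex.I * s) h1 (by fun_prop)
  refine (hasDerivAt_integral_of_dominated_loc_of_deriv_le
    (s := {w : ℂ | w.re ∈ Ioo a' b'})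
    (F := fun (z : ℂ) (s : ℝ) => Complex.exp (ψ (z + Complex.I * s)))
    (F' := fun (z : ℂ) (s : ℝ) => deriv (fun w => Complex.exp (ψ w)) (z + Complex.I * s))
    (bound := fun _ => Real.exp K * D)
    (hopen.mem_nhds ⟨ha2, hb1⟩) ?_ ?_ ?_ ?_ ?_ ?_).2.differentiableAt
  · filter_upwards [hopen.mem_nhds ⟨ha2, hb1⟩] with w hw
    exact (hcont w hw).aestronglyMeasurable
  · refine (integrable_const (Real.exp K)).mono' (hcont z ⟨ha2, hb1⟩).aestronglyMeasurable
      (ae_of_all _ fun s => hF _ ?_)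
    rw [hre]; exact ⟨ha2, hb1⟩
  · exact hcont'.aestronglyMeasurable
  · refine ae_of_all _ fun s w hw => ?_
    have hw' : (w + Complex.I * s).re ∈ Ioo a' b' := by rw [hre]; exact hw
    rw [(hd2 _ hw').deriv, norm_mul]
    exact mul_le_mul (hF _ hw') (hψb _ hw') (norm_nonneg _) (Real.exp_nonneg _)
  · exact integrable_const _
  · refine ae_of_all _ fun s w hw => ?_
    have hw' : (w + Complex.I * s).re ∈ Ioo a' b' := by rw [hre]; exact hw
    rw [(hd2 _ hw').deriv]
    exact (hd2 _ hw').comp_add_const w (Complex.I * s)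

lemma cg_ident {a b : ℝ} (ha : a < 0) (hb : 0 < b) {f g : ℂ → ℂ}
    (hf : ∀ z : ℂ, z.re ∈ Ioo a b → DifferentiableAt ℂ f z)
    (hg : ∀ z : ℂ, z.re ∈ Ioo a b → DifferentiableAt ℂ g z)
    (hfg : ∀ t : ℝ, f (Complex.I * t) = g (Complex.I * t)) :
    ∀ z : ℂ, z.re ∈ Ioo a b → f z = g z := by
  have hopen : IsOpen {w : ℂ | w.re ∈ Ioo a b} := isOpen_Ioo.preimage Complex.continuous_re
  have hconv : Convex ℝ {w : ℂ | w.re ∈ Ioo a b} :=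
    (convex_Ioo a b).linear_preimage Complex.reLm
  have h1 : AnalyticOnNhd ℂ f {w : ℂ | w.re ∈ Ioo a b} :=
    DifferentiableOn.analyticOnNhd (fun z hz => (hf z hz).differentiableWithinAt) hopen
  have h2 : AnalyticOnNhd ℂ g {w : ℂ | w.re ∈ Ioo a b} :=
    DifferentiableOn.analyticOnNhd (fun z hz => (hg z hz).differentiableWithinAt) hopen
  refine h1.eqOn_of_preconnected_of_frequently_eq h2 hconv.isPreconnected (z₀ := 0)
    (by simp [ha, hb]) ?_
  have ht : Tendsto (fun t : ℝ => Complex.I * t) (𝓝[≠] 0) (𝓝[≠] 0) := by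
    refine tendsto_nhdsWithin_iff.2 ⟨?_, ?_⟩
    · have : Continuous fun t : ℝ => Complex.I * t := by fun_prop
      simpa using (this.tendsto 0).mono_left nhdsWithin_le_nhds
    · filter_upwards [self_mem_nhdsWithin] with t ht
      simpa using ht
  exact ht.frequently (Frequently.of_forall hfg)

lemma cg_tilt_int {Ω : Type*} [MeasurableSpace Ω] {P : Measure Ω} [IsProbabilityMeasure P]
    {X : Ω → ℝ} (hX : Measurable X) {v : ℝ} (hv : 0 < v) (x : ℝ) :
    Integrable (fun ω => Real.exp (-(v * X ω ^ 2 / 2)) * Real.exp (x * X ω)) P := by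
  refine (integrable_const (Real.exp (x ^ 2 / (2 * v)))).mono' (by fun_prop)
    (ae_of_all _ fun ω => ?_)
  rw [← Real.exp_add, Real.norm_eq_abs, Real.abs_exp, Real.exp_le_exp]
  have : x ^ 2 / (2 * v) - (-(v * X ω ^ 2 / 2) + x * X ω) = (x - v * X ω) ^ 2 / (2 * v) := by
    field_simp; ring
  have h2 : 0 ≤ (x - v * X ω) ^ 2 / (2 * v) := by positivity
  linarith

lemma cg_bound {Ω : Type*} [MeasurableSpace Ω] {P : Measure Ω} [IsProbabilityMeasure P]
    {X : Ω → ℝ} (hX : Measurable X)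
    {ν : Measure ℝ} {a b : ℝ} (ha : a < 0) (hb : 0 < b)
    (hint : ∀ x ∈ Ioo a b, Integrable (fun u => |u| * Real.exp (x * u)) ν)
    (hcf : ∀ t : ℝ, ∫ ω, Complex.exp (Complex.I * t * X ω) ∂P
        = Complex.exp (∫ u : ℝ, (Complex.exp (Complex.I * t * u) - 1) ∂ν))
    {x : ℝ} (hx : x ∈ Ioo a b) {v : NNReal} (hv : 0 < v) :
    ∫ ω, Real.exp (-(v * X ω ^ 2 / 2)) * Real.exp (x * X ω) ∂P ≤
      Real.exp (∫ u : ℝ, (Complex.exp ((x : ℂ) * u) - 1) ∂ν).re := by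
  set d : Ω → ENNReal := fun ω => ENNReal.ofReal (Real.exp (-(v * X ω ^ 2 / 2))) with hd
  have hdm : Measurable d := by fun_prop
  have hdt : ∀ᵐ ω ∂P, d ω < ⊤ := ae_of_all _ fun ω => ENNReal.ofReal_lt_top
  have hdr : ∀ ω, (d ω).toReal = Real.exp (-(v * X ω ^ 2 / 2)) := fun ω =>
    ENNReal.toReal_ofReal (Real.exp_nonneg _)
  have hset : integrableExpSet X (P.withDensity d) = univ := by
    refine eq_univ_of_forall fun t => ?_
    change Integrable _ _
    rw [integrable_withDensity_iff_integrable_smul' hdm hdt]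
    simp only [hdr, smul_eq_mul]
    exact cg_tilt_int hX (by exact_mod_cast hv) t
  have hG : ∀ z : ℂ, DifferentiableAt ℂ (complexMGF X (P.withDensity d)) z := fun z =>
    (hasDerivAt_complexMGF (by simp [hset])).differentiableAt
  have hGe : ∀ z : ℂ, complexMGF X (P.withDensity d) z =
      ∫ ω, (Real.exp (-(v * X ω ^ 2 / 2)) : ℂ) * Complex.exp (z * X ω) ∂P := by
    intro z
    rw [complexMGF, integral_withDensity_eq_integral_toReal_smul hdm hdt]
    simp only [hdr, Complex.real_smul]
  have key := cg_ident ha hb (f := complexMGF X (P.withDensity d)) (fun z _ => hG z)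
    (fun z hz => cg_H_diff ha hb hint (gaussianReal 0 v) hz) (fun t => by
      rw [hGe]
      have e1 : ∀ ω, (Real.exp (-(v * X ω ^ 2 / 2)) : ℂ) * Complex.exp (Complex.I * t * X ω)
          = ∫ s : ℝ, Complex.exp (Complex.I * ((t + s : ℝ) : ℂ) * X ω) ∂(gaussianReal 0 v) := by
        intro ω
        have h := charFun_gaussianReal (μ := 0) (v := v) (X ω)
        rw [charFun_apply_real] at h
        have h3 : ∀ s : ℝ, Complex.exp (Complex.I * ((t + s : ℝ) : ℂ) * X ω) =
            Complex.exp (Complex.I * t * X ω) * Complex.exp (X ω * s * Complex.I) := by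
          intro s
          rw [← Complex.exp_add]; push_cast; ring_nf
        simp_rw [h3]
        rw [integral_const_mul, h, mul_comm]
        push_cast
        simp
      simp_rw [e1]
      rw [integral_integral_swap]
      · refine integral_congr_ae (ae_of_all _ fun s => ?_)
        simp only []
        rw [hcf (t + s)]
        push_cast
        simp only [mul_add]
      · refine (integrable_const (1 : ℝ)).mono' ?_ (ae_of_all _ fun p => ?_)
        · refine Measurable.aestronglyMeasurable ?_
          unfold Function.uncurry
          fun_prop
        · simp only [Function.uncurry]
          rw [Complex.norm_exp]
          simp [Complex.mul_re])
  have h := key x (by simpa using hx)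
  rw [hGe] at h
  have h4 : (∫ ω, (Real.exp (-(v * X ω ^ 2 / 2)) : ℂ) * Complex.exp (x * X ω) ∂P) =
      ((∫ ω, Real.exp (-(v * X ω ^ 2 / 2)) * Real.exp (x * X ω) ∂P : ℝ) : ℂ) := by
    rw [← integral_complex_ofReal]
    push_cast
    rfl
  rw [h4] at h
  have h5 := congrArg norm h
  rw [Complex.norm_real] at h5
  refine (le_abs_self _).trans (h5.le.trans ?_)
  refine (norm_integral_le_of_norm_le (integrable_const (Real.exp
    (∫ u : ℝ, (Complex.exp ((x : ℂ) * u) - 1) ∂ν).re)) (ae_of_all _ fun s => ?_)).trans ?_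
  · rw [Complex.norm_exp, Real.exp_le_exp]
    have := cg_re_le ha hb hint (z := (x : ℂ) + Complex.I * s) (by simpa using hx)
    simpa using this
  · simp

lemma cg_expInt {Ω : Type*} [MeasurableSpace Ω] {P : Measure Ω} [IsProbabilityMeasure P]
    {X : Ω → ℝ} (hX : Measurable X)
    {ν : Measure ℝ} {a b : ℝ} (ha : a < 0) (hb : 0 < b)
    (hint : ∀ x ∈ Ioo a b, Integrable (fun u => |u| * Real.exp (x * u)) ν)
    (hcf : ∀ t : ℝ, ∫ ω, Complex.exp (Complex.I * t * X ω) ∂P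
        = Complex.exp (∫ u : ℝ, (Complex.exp (Complex.I * t * u) - 1) ∂ν))
    {x : ℝ} (hx : x ∈ Ioo a b) : Integrable (fun ω => Real.exp (x * X ω)) P := by
  set C := Real.exp (∫ u : ℝ, (Complex.exp ((x : ℂ) * u) - 1) ∂ν).re with hC
  let v : ℕ → NNReal := fun n => 1 / ((n : NNReal) + 1)
  have hv : ∀ n, 0 < v n := fun n => by positivity
  have hvt : Tendsto (fun n => (v n : ℝ)) atTop (𝓝 0) := by
    have := tendsto_one_div_add_atTop_nhds_zero_nat (𝕜 := ℝ)
    simpa [v] using this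
  let f : ℕ → Ω → ENNReal := fun n ω =>
    ENNReal.ofReal (Real.exp (-(v n * X ω ^ 2 / 2)) * Real.exp (x * X ω))
  have hlim : ∀ ω, Tendsto (fun n => f n ω) atTop (𝓝 (ENNReal.ofReal (Real.exp (x * X ω)))) := by
    intro ω
    refine ENNReal.tendsto_ofReal ?_
    have h1 : Tendsto (fun n => -((v n : ℝ) * X ω ^ 2 / 2)) atTop (𝓝 0) := by
      simpa using ((hvt.mul_const (X ω ^ 2)).div_const 2).neg
    have h2 := ((Real.continuous_exp.tendsto 0).comp h1).mul_const (Real.exp (x * X ω))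
    simpa using h2
  have hle : ∫⁻ ω, ENNReal.ofReal (Real.exp (x * X ω)) ∂P ≤ ENNReal.ofReal C := by
    calc ∫⁻ ω, ENNReal.ofReal (Real.exp (x * X ω)) ∂P
        = ∫⁻ ω, liminf (fun n => f n ω) atTop ∂P :=
          lintegral_congr fun ω => (hlim ω).liminf_eq.symm
      _ ≤ liminf (fun n => ∫⁻ ω, f n ω ∂P) atTop :=
          lintegral_liminf_le fun n => by fun_prop
      _ ≤ ENNReal.ofReal C := by
          refine liminf_le_of_le (by isBoundedDefault) fun c hc => ?_
          obtain ⟨n, hn⟩ := hc.exists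
          refine hn.trans ?_
          rw [← ofReal_integral_eq_lintegral_ofReal (cg_tilt_int hX (by exact_mod_cast hv n) x)
            (ae_of_all _ fun ω => by positivity)]
          exact ENNReal.ofReal_le_ofReal (cg_bound hX ha hb hint hcf hx (hv n))
  refine ⟨by fun_prop, ?_⟩
  rw [hasFiniteIntegral_iff_ofReal (ae_of_all _ fun ω => Real.exp_nonneg _)]
  exact hle.trans_lt ENNReal.ofReal_lt_top

lemma cg_main {Ω : Type*} [MeasurableSpace Ω] {P : Measure Ω} [IsProbabilityMeasure P]
    {X : Ω → ℝ} (hX : Measurable X)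
    {ν : Measure ℝ} {a b : ℝ} (ha : a < 0) (hb : 0 < b)
    (hint : ∀ x ∈ Ioo a b, Integrable (fun u => |u| * Real.exp (x * u)) ν)
    (hcf : ∀ t : ℝ, ∫ ω, Complex.exp (Complex.I * t * X ω) ∂P
        = Complex.exp (∫ u : ℝ, (Complex.exp (Complex.I * t * u) - 1) ∂ν))
    {x : ℝ} (hx : x ∈ Ioo a b) :
    (∫ ω, X ω * Real.exp (x * X ω) ∂P) / (∫ ω, Real.exp (x * X ω) ∂P)
      = ∫ u, u * Real.exp (x * u) ∂ν := by
  have hsub : Ioo a b ⊆ interior (integrableExpSet X P) :=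
    interior_maximal (fun y hy => cg_expInt hX ha hb hint hcf hy) isOpen_Ioo
  have key := cg_ident ha hb (f := complexMGF X P)
    (g := fun z => Complex.exp (∫ u : ℝ, (Complex.exp (z * u) - 1) ∂ν))
    (fun z hz => (hasDerivAt_complexMGF (hsub hz)).differentiableAt)
    (fun z hz => (cg_deriv ha hb hint hz).cexp.differentiableAt)
    (fun t => hcf t)
  have hopen : IsOpen {w : ℂ | w.re ∈ Ioo a b} := isOpen_Ioo.preimage Complex.continuous_re
  have hxc : (x : ℂ).re ∈ Ioo a b := by simpa using hx
  have d1 := hasDerivAt_complexMGF (hsub hxc)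
  have d2 := (cg_deriv ha hb hint hxc).cexp
  have d3 := d2.congr_of_eventuallyEq (f₁ := complexMGF X P)
    (by filter_upwards [hopen.mem_nhds hxc] with z hz using key z hz)
  have e := d1.unique d3
  have k := key x hxc
  rw [← k] at e
  have k1 : complexMGF X P x = ((∫ ω, Real.exp (x * X ω) ∂P : ℝ) : ℂ) := by
    rw [← integral_complex_ofReal, complexMGF]
    push_cast
    rfl
  have k2 : (∫ ω, (X ω : ℂ) * Complex.exp (x * X ω) ∂P) =
      ((∫ ω, X ω * Real.exp (x * X ω) ∂P : ℝ) : ℂ) := by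
    rw [← integral_complex_ofReal]
    push_cast
    rfl
  have k3 : (∫ u : ℝ, (u : ℂ) * Complex.exp (x * u) ∂ν) =
      ((∫ u, u * Real.exp (x * u) ∂ν : ℝ) : ℂ) := by
    rw [← integral_complex_ofReal]
    push_cast
    rfl
  have hne : (∫ ω, Real.exp (x * X ω) ∂P) ≠ 0 := by
    intro h0
    rw [k1, h0] at k
    exact (Complex.exp_ne_zero _) (k.symm.trans Complex.ofReal_zero)
  rw [k1, k2, k3] at e
  rw [div_eq_iff hne]
  have e' : (∫ ω, X ω * Real.exp (x * X ω) ∂P) =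
    (∫ ω, Real.exp (x * X ω) ∂P) * ∫ u, u * Real.exp (x * u) ∂ν := by exact_mod_cast e
  rw [e', mul_comm]

lemma cg_half {β r : ℝ} (hβ : β ∈ Ico (0:ℝ) 1) (hr : 0 < r) :
    IntegrableOn (fun u : ℝ => u ^ (-β) * Real.exp (-(r * u))) (Ioi 0) ∧
    ∫ u in Ioi (0:ℝ), u ^ (-β) * Real.exp (-(r * u)) = Real.Gamma (1 - β) / r ^ (1 - β) := by
  constructor
  · have := integrableOn_rpow_mul_exp_neg_mul_rpow (p := 1) (s := -β) (b := r)
      (by linarith [hβ.2]) one_pos hr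
    simpa using this
  · have := Real.integral_rpow_mul_exp_neg_mul_Ioi (a := 1 - β) (r := r) (by linarith [hβ.2]) hr
    rw [show 1 - β - 1 = -β by ring] at this
    rw [this, Real.div_rpow zero_le_one hr.le, Real.one_rpow]
    ring

lemma cg_levy {α β lp lm : ℝ} (hα : 0 < α) (hβ : β ∈ Ico (0:ℝ) 1) {ν : Measure ℝ}
    (hν : ν = volume.withDensity (fun u => ENNReal.ofReal
        ((Ioi (0:ℝ)).indicator (fun u => α * u ^ (-1 - β) * Real.exp (-lp * u)) u
          + (Iio (0:ℝ)).indicator (fun u => α * |u| ^ (-1 - β) * Real.exp (-lm * |u|)) u)))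
    {x : ℝ} (hx : x ∈ Ioo (-lm) lp) :
    Integrable (fun u => |u| * Real.exp (x * u)) ν ∧
    ∫ u, u * Real.exp (x * u) ∂ν = α * Real.Gamma (1 - β) / (lp - x) ^ (1 - β)
        - α * Real.Gamma (1 - β) / (lm + x) ^ (1 - β) := by
  obtain ⟨p1, p2⟩ := cg_half hβ (r := lp - x) (by linarith [hx.2])
  obtain ⟨m1, m2⟩ := cg_half hβ (r := lm + x) (by linarith [hx.1])
  set P : ℝ → ℝ := (Ioi (0:ℝ)).indicator
    (fun u => α * (u ^ (-β) * Real.exp (-((lp - x) * u)))) with hP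
  set M : ℝ → ℝ := (Ioi (0:ℝ)).indicator
    (fun u => α * (u ^ (-β) * Real.exp (-((lm + x) * u)))) with hM
  have iP : Integrable P := (integrable_indicator_iff measurableSet_Ioi).2 (p1.const_mul α)
  have iM : Integrable M := (integrable_indicator_iff measurableSet_Ioi).2 (m1.const_mul α)
  have iM' : Integrable (fun u => M (-u)) := iM.comp_neg
  set d : ℝ → ℝ := fun u =>
    ((Ioi (0:ℝ)).indicator (fun u => α * u ^ (-1 - β) * Real.exp (-lp * u)) u
          + (Iio (0:ℝ)).indicator (fun u => α * |u| ^ (-1 - β) * Real.exp (-lm * |u|)) u) with hd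
  have hd0 : ∀ u, 0 ≤ d u := by
    intro u
    refine add_nonneg (indicator_nonneg (fun y hy => ?_) _) (indicator_nonneg (fun y hy => ?_) _)
    · have : (0:ℝ) < y := hy
      positivity
    · positivity
  have hdm : Measurable d := by
    refine Measurable.add (Measurable.indicator ?_ measurableSet_Ioi)
      (Measurable.indicator ?_ measurableSet_Iio)
    · fun_prop
    · have : Measurable fun u : ℝ => |u| := measurable_norm
      fun_prop
  have hpow : ∀ u : ℝ, 0 < u → u ^ (-1 - β) * u = u ^ (-β) := by
    intro u hu
    rw [← Real.rpow_add_one hu.ne']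
    ring_nf
  have e1 : ∀ u, d u * (u * Real.exp (x * u)) = P u - M (-u) := by
    intro u
    rcases lt_trichotomy u 0 with hu | hu | hu
    · have h1 : ¬ 0 < u := not_lt.2 hu.le
      simp only [hd, hP, hM, indicator, mem_Ioi, mem_Iio, hu, h1, if_true, if_false,
        Left.neg_pos_iff, abs_of_neg hu]
      rw [← hpow (-u) (by linarith), show -((lm + x) * -u) = -lm * -u + x * u by ring,
        Real.exp_add]
      ring
    · subst hu; simp [hP, hM]
    · have h1 : ¬ u < 0 := not_lt.2 hu.le
      simp only [hd, hP, hM, indicator, mem_Ioi, mem_Iio, hu, h1, if_true, if_false,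
        Left.neg_pos_iff]
      rw [← hpow u hu, show -((lp - x) * u) = -lp * u + x * u by ring, Real.exp_add]
      ring
  have e2 : ∀ u, d u * (|u| * Real.exp (x * u)) = P u + M (-u) := by
    intro u
    rcases lt_trichotomy u 0 with hu | hu | hu
    · have h1 : ¬ 0 < u := not_lt.2 hu.le
      have := e1 u
      have hPz : P u = 0 := by simp [hP, h1]
      rw [abs_of_neg hu]
      rw [hPz] at this ⊢
      linarith
    · subst hu; simp [hP, hM]
    · have h1 : ¬ u < 0 := not_lt.2 hu.le
      have := e1 u
      have hMz : M (-u) = 0 := by simp [hM, h1]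
      rw [abs_of_pos hu]
      rw [hMz] at this ⊢
      linarith
  have hdr : ∀ u, (ENNReal.ofReal (d u)).toReal = d u := fun u => ENNReal.toReal_ofReal (hd0 u)
  have hdt : ∀ᵐ u : ℝ, ENNReal.ofReal (d u) < ⊤ := ae_of_all _ fun _ => ENNReal.ofReal_lt_top
  have hν' : ν = volume.withDensity (fun u => ENNReal.ofReal (d u)) := hν
  rw [hν']
  constructor
  · rw [integrable_withDensity_iff_integrable_smul' hdm.ennreal_ofReal hdt]
    simp only [hdr, smul_eq_mul, e2]
    exact iP.add iM'
  · rw [integral_withDensity_eq_integral_toReal_smul hdm.ennreal_ofReal hdt]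
    simp only [hdr, smul_eq_mul, e1]
    rw [integral_sub iP iM', integral_neg_eq_self M volume, hP, hM,
      integral_indicator measurableSet_Ioi, integral_indicator measurableSet_Ioi,
      integral_const_mul, integral_const_mul, p2, m2]
    ring


/-- **Esscher premium principle for the CGMY distribution.**
If `X ~ CGMY(α, β, λ⁺, λ⁻)` and `0 < κ < λ⁺`, then
`E[X e^{κX}]/E[e^{κX}] = αΓ(1-β)/(λ⁺-κ)^{1-β} - αΓ(1-β)/(λ⁻+κ)^{1-β}`. -/
theorem esscher_premium_CGMY
    {Ω : Type*} [MeasureSpace Ω] [IsProbabilityMeasure (ℙ : Measure Ω)]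
    (α β lp lm : ℝ) (hα : 0 < α) (hlp : 0 < lp) (hlm : 0 < lm)
    (hβ : β ∈ Ico (0:ℝ) 1)
    (X : Ω → ℝ) (hX : Measurable X)
    -- the CGMY Lévy measure
    (ν : Measure ℝ)
    (hν : ν = volume.withDensity (fun u => ENNReal.ofReal
        ((Ioi (0:ℝ)).indicator (fun u => α * u ^ (-1 - β) * Real.exp (-lp * u)) u
          + (Iio (0:ℝ)).indicator (fun u => α * |u| ^ (-1 - β) * Real.exp (-lm * |u|)) u)))
    -- X ~ CGMY(α, β, λ⁺, λ⁻)
    (hcf : ∀ t : ℝ,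
      ∫ ω, Complex.exp (Complex.I * t * X ω) ∂ℙ
        = Complex.exp (∫ u : ℝ, (Complex.exp (Complex.I * t * u) - 1) ∂ν))
    (κ : ℝ) (hκ : 0 < κ) (hκlp : κ < lp) :
    (∫ ω, X ω * Real.exp (κ * X ω) ∂ℙ) / (∫ ω, Real.exp (κ * X ω) ∂ℙ)
      = α * Real.Gamma (1 - β) / (lp - κ) ^ (1 - β)
        - α * Real.Gamma (1 - β) / (lm + κ) ^ (1 - β) := by
  have hint : ∀ x ∈ Ioo (-lm) lp, Integrable (fun u => |u| * Real.exp (x * u)) ν :=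
    fun x hx => (cg_levy hα hβ hν hx).1
  have hκm : κ ∈ Ioo (-lm) lp := ⟨by linarith, hκlp⟩
  rw [cg_main hX (by linarith) hlp hint hcf hκm]
  exact (cg_levy hα hβ hν hκm).2
end

section
/- Let X ~ IDD(μ, 0, ν) with μ = E[X] > 0 and ∫_ℝ u² ν(du) < ∞, and let F_X(x) = ℙ(X ≤ x) be the cumulative distribution function of X. Then the Gini coefficient G = (2/μ) Cov(X, F_X(X)) admits the representation G = (2/μ) E[ ∫_ℝ u (F_X(X+u) − F_X(X)) ν(du) ]. -/
open MeasureTheory ProbabilityTheory Set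

section GiniAux

open Filter Topology

lemma aux_sfinite (ν : Measure ℝ) (hν0 : ν {0} = 0)
    (hν2 : Integrable (fun u : ℝ => u ^ 2) ν) : SFinite ν := by
  have hm : Measurable (fun u : ℝ => ENNReal.ofReal (u ^ 2)) := by fun_prop
  have h1 : IsFiniteMeasure (ν.withDensity (fun u : ℝ => ENNReal.ofReal (u ^ 2))) :=
    isFiniteMeasure_withDensity_ofReal hν2.2
  have h0 : ∀ᵐ u ∂ν, ENNReal.ofReal (u ^ 2) ≠ 0 := by
    have : ∀ᵐ u ∂ν, u ≠ 0 := by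
      rw [ae_iff]; simpa using hν0
    filter_upwards [this] with u hu
    simp [ENNReal.ofReal_eq_zero]
    positivity
  rw [← withDensity_inv_same hm h0 (by simp)]
  infer_instance

lemma aux_bound2 (y : ℝ) :
    ‖Complex.exp (Complex.I * y) - 1 - Complex.I * y‖ ≤ 3 * y ^ 2 := by
  rcases le_or_gt |y| 1 with h | h
  · have := Complex.norm_exp_sub_one_sub_id_le (x := Complex.I * y) (by simpa using h)
    simp only [norm_mul, Complex.norm_I, one_mul, Complex.norm_real, Real.norm_eq_abs, sq_abs] at this
    nlinarith [sq_nonneg y]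
  · have h1 := Real.norm_exp_I_mul_ofReal_sub_one_le (x := y)
    have h2 := norm_sub_le (Complex.exp (Complex.I * y) - 1) (Complex.I * y)
    simp only [norm_mul, Complex.norm_I, one_mul, Complex.norm_real, Real.norm_eq_abs] at h1 h2
    nlinarith [sq_abs y]

lemma aux_psi_bound (ν : Measure ℝ) (hν2 : Integrable (fun u : ℝ => u ^ 2) ν) (t : ℝ) :
    ‖∫ u : ℝ, (Complex.exp (Complex.I * t * u) - 1 - Complex.I * t * u) ∂ν‖
      ≤ t ^ 2 * (3 * ∫ u, u ^ 2 ∂ν) := by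
  have : t ^ 2 * (3 * ∫ u, u ^ 2 ∂ν) = ∫ u, 3 * (t * u) ^ 2 ∂ν := by
    rw [← integral_const_mul, ← integral_const_mul]
    congr 1; ext u; ring
  rw [this]
  refine norm_integral_le_of_norm_le ?_ (ae_of_all _ fun u => ?_)
  · have : (fun u : ℝ => 3 * (t * u) ^ 2) = fun u => (3 * t ^ 2) * u ^ 2 := by ext u; ring
    rw [this]; exact hν2.const_mul _
  · have := aux_bound2 (t * u)
    push_cast at this
    simpa only [mul_assoc] using this

lemma aux_cos (y : ℝ) (h : |y| ≤ 1) : y ^ 2 / 4 ≤ 1 - Real.cos y := by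
  have := (abs_le.1 (Real.cos_bound h)).2
  have h4 : |y| ^ 4 ≤ y ^ 2 := by
    have : |y| ^ 4 = y ^ 2 * |y| ^ 2 := by rw [← sq_abs y]; ring
    rw [this]
    have : |y| ^ 2 ≤ 1 := by nlinarith [abs_nonneg y]
    nlinarith [sq_nonneg y]
  nlinarith [sq_nonneg y]

lemma aux_L2 (P : Measure ℝ) [IsProbabilityMeasure P] (μ : ℝ) (ν : Measure ℝ)
    (hν2 : Integrable (fun u : ℝ => u ^ 2) ν)
    (hcf : ∀ t : ℝ,
      ∫ x : ℝ, Complex.exp (Complex.I * t * x) ∂P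
        = Complex.exp (Complex.I * t * μ
            + ∫ u : ℝ, (Complex.exp (Complex.I * t * u) - 1 - Complex.I * t * u) ∂ν)) :
    Integrable (fun x : ℝ => (x - μ) ^ 2) P := by
  set V : ℝ := 3 * ∫ u, u ^ 2 ∂ν with hV
  have hV0 : 0 ≤ V := by
    have : 0 ≤ ∫ u : ℝ, u ^ 2 ∂ν := integral_nonneg fun u => sq_nonneg u
    positivity
  -- the basic estimate
  have key : ∀ t : ℝ, t ^ 2 * V ≤ 1 → ∫ x : ℝ, (1 - Real.cos (t * (x - μ))) ∂P ≤ 2 * (t ^ 2 * V) := by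
    intro t ht
    have hint : Integrable (fun x : ℝ => Complex.exp (Complex.I * t * (x - μ))) P := by
      refine Integrable.of_bound (C := 1) (by fun_prop) (ae_of_all _ fun x => ?_)
      have : Complex.I * t * (x - μ) = (t * (x - μ) : ℝ) * Complex.I := by push_cast; ring
      rw [this, Complex.norm_exp_ofReal_mul_I]
    have e1 : ∫ x : ℝ, Complex.exp (Complex.I * t * (x - μ)) ∂P
        = Complex.exp (∫ u : ℝ, (Complex.exp (Complex.I * t * u) - 1 - Complex.I * t * u) ∂ν) := by
      have : ∀ x : ℝ, Complex.exp (Complex.I * t * (x - μ))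
          = Complex.exp (-(Complex.I * t * μ)) * Complex.exp (Complex.I * t * x) := by
        intro x; rw [← Complex.exp_add]; congr 1; ring
      simp_rw [this]
      rw [integral_const_mul, hcf, ← Complex.exp_add]
      congr 1; ring
    have e2 : ∫ x : ℝ, (1 - Real.cos (t * (x - μ))) ∂P
        = (∫ x : ℝ, (1 - Complex.exp (Complex.I * t * (x - μ))) ∂P).re := by
      have hi : Integrable (fun x : ℝ => 1 - Complex.exp (Complex.I * t * (x - μ))) P :=
        (integrable_const _).sub hint
      rw [← RCLike.re_eq_complex_re, ← integral_re hi]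
      congr 1; ext x
      have : Complex.I * t * (x - μ) = (t * (x - μ) : ℝ) * Complex.I := by push_cast; ring
      rw [this, Complex.exp_mul_I]
      simp [← Complex.ofReal_cos, ← Complex.ofReal_sin]
      norm_cast
      simp
    rw [e2, integral_sub (integrable_const _) hint, e1]
    simp only [integral_const, probReal_univ, one_smul]
    have hb := aux_psi_bound ν hν2 t
    refine (Complex.re_le_norm _).trans ?_
    rw [norm_sub_rev]
    refine (Complex.norm_exp_sub_one_le (hb.trans ht)).trans ?_
    linarith
  have hlin : ∫⁻ x, ENNReal.ofReal ((x - μ) ^ 2) ∂P ≤ ENNReal.ofReal (8 * V) := by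
    let t : ℕ → ℝ := fun n => 1 / ((n : ℝ) + 1)
    have htpos : ∀ n, 0 < t n := fun n => by positivity
    have htl : Tendsto t atTop (𝓝 0) := tendsto_one_div_add_atTop_nhds_zero_nat
    calc ∫⁻ x, ENNReal.ofReal ((x - μ) ^ 2) ∂P
        ≤ ∫⁻ x, liminf (fun n => ENNReal.ofReal (4 / t n ^ 2 * (1 - Real.cos (t n * (x - μ))))) atTop ∂P := by
          refine lintegral_mono fun x => ?_
          refine le_liminf_of_le (by isBoundedDefault) ?_
          have : Tendsto (fun n => |t n * (x - μ)|) atTop (𝓝 |0 * (x - μ)|) :=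
            (htl.mul_const _).abs
          have := this.eventually_le_const (u := 1) (by simp)
          filter_upwards [this] with n hn
          refine ENNReal.ofReal_le_ofReal ?_
          have h1 := aux_cos _ hn
          have h2 := htpos n
          calc (x - μ) ^ 2 = 4 / t n ^ 2 * ((t n * (x - μ)) ^ 2 / 4) := by field_simp
            _ ≤ _ := by gcongr
      _ ≤ liminf (fun n => ∫⁻ x, ENNReal.ofReal (4 / t n ^ 2 * (1 - Real.cos (t n * (x - μ)))) ∂P) atTop :=
          lintegral_liminf_le fun n => by fun_prop
      _ ≤ ENNReal.ofReal (8 * V) := by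
          refine liminf_le_of_frequently_le' (Eventually.frequently ?_)
          have : Tendsto (fun n => t n ^ 2 * V) atTop (𝓝 (0 ^ 2 * V)) := (htl.pow 2).mul_const _
          have := this.eventually_le_const (u := 1) (by simp)
          filter_upwards [this] with n hn
          rw [← ofReal_integral_eq_lintegral_ofReal]
          · refine ENNReal.ofReal_le_ofReal ?_
            rw [integral_const_mul]
            have h1 := key _ hn
            have h2 := htpos n
            calc 4 / t n ^ 2 * ∫ x : ℝ, (1 - Real.cos (t n * (x - μ))) ∂P
                ≤ 4 / t n ^ 2 * (2 * (t n ^ 2 * V)) := by gcongr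
              _ = 8 * V := by field_simp; ring
          · refine Integrable.const_mul ?_ _
            refine Integrable.of_bound (C := 2) (by fun_prop) (ae_of_all _ fun x => ?_)
            rw [Real.norm_eq_abs, abs_le]
            constructor <;> linarith [Real.cos_le_one (t n * (x - μ)), Real.neg_one_le_cos (t n * (x - μ))]
          · refine ae_of_all _ fun x => ?_
            have h2 := htpos n
            have := Real.cos_le_one (t n * (x - μ))
            have : 0 ≤ 1 - Real.cos (t n * (x - μ)) := by linarith
            show 0 ≤ _
            positivity
  refine ⟨by fun_prop, ?_⟩
  rw [hasFiniteIntegral_iff_ofReal (ae_of_all _ fun x => sq_nonneg _)]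
  exact hlin.trans_lt ENNReal.ofReal_lt_top

lemma aux_deriv (P : Measure ℝ) [IsProbabilityMeasure P] (μ : ℝ) (ν : Measure ℝ)
    (hP : Integrable (fun x : ℝ => x) P)
    (hν2 : Integrable (fun u : ℝ => u ^ 2) ν)
    (hcf : ∀ t : ℝ,
      ∫ x : ℝ, Complex.exp (Complex.I * t * x) ∂P
        = Complex.exp (Complex.I * t * μ
            + ∫ u : ℝ, (Complex.exp (Complex.I * t * u) - 1 - Complex.I * t * u) ∂ν)) (t : ℝ) :
    ∫ x : ℝ, ((x : ℂ) - μ) * Complex.exp (Complex.I * t * x) ∂P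
      = (∫ x : ℝ, Complex.exp (Complex.I * t * x) ∂P) *
        ∫ u : ℝ, (u : ℂ) * (Complex.exp (Complex.I * t * u) - 1) ∂ν := by
  have hnorm : ∀ s x : ℝ, ‖Complex.exp (Complex.I * s * x)‖ = 1 := by
    intro s x
    have : Complex.I * s * x = (s * x : ℝ) * Complex.I := by push_cast; ring
    rw [this, Complex.norm_exp_ofReal_mul_I]
  have hexpd : ∀ s x : ℝ, HasDerivAt (fun s : ℝ => Complex.exp (Complex.I * s * x))
      (Complex.exp (Complex.I * s * x) * (Complex.I * x)) s := by
    intro s x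
    have h1 : HasDerivAt (fun s : ℝ => Complex.I * (s : ℂ) * x) (Complex.I * x) s := by
      have := ((Complex.ofRealCLM.hasDerivAt (x := s)).const_mul Complex.I).mul_const (x : ℂ)
      simpa using this
    exact h1.cexp
  have hexpint : Integrable (fun x : ℝ => Complex.exp (Complex.I * t * x)) P :=
    Integrable.of_bound (C := 1) (by fun_prop) (ae_of_all _ fun x => (hnorm t x).le)
  -- derivative of the characteristic function
  have d1 := (hasDerivAt_integral_of_dominated_loc_of_deriv_le (μ := P)
    (F := fun (s : ℝ) (x : ℝ) => Complex.exp (Complex.I * s * x))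
    (F' := fun (s : ℝ) (x : ℝ) => Complex.exp (Complex.I * s * x) * (Complex.I * x))
    (x₀ := t) (s := univ) (bound := fun x => |x|) univ_mem
    (Eventually.of_forall fun s => by fun_prop) hexpint (by fun_prop)
    (ae_of_all _ fun x s _ => by simp [hnorm]) hP.abs
    (ae_of_all _ fun x s _ => hexpd s x))
  have hb : ∀ s u : ℝ, ‖Complex.exp (Complex.I * s * u) * (Complex.I * u) - Complex.I * u‖ ≤ |s| * u ^ 2 := by
    intro s u
    have h1 := Real.norm_exp_I_mul_ofReal_sub_one_le (x := s * u)
    push_cast at h1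
    rw [← mul_assoc, norm_mul, Real.norm_eq_abs, Real.norm_eq_abs] at h1
    have : Complex.exp (Complex.I * s * u) * (Complex.I * u) - Complex.I * u
      = (Complex.exp (Complex.I * s * u) - 1) * (Complex.I * u) := by ring
    rw [this, norm_mul, norm_mul, Complex.norm_I, one_mul, Complex.norm_real, Real.norm_eq_abs]
    calc _ ≤ |s| * |u| * |u| := by gcongr
      _ = |s| * u ^ 2 := by rw [mul_assoc, ← sq, sq_abs]
  have d2 := (hasDerivAt_integral_of_dominated_loc_of_deriv_le (μ := ν)
    (F := fun (s : ℝ) (u : ℝ) => Complex.exp (Complex.I * s * u) - 1 - Complex.I * s * u)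
    (F' := fun (s : ℝ) (u : ℝ) => Complex.exp (Complex.I * s * u) * (Complex.I * u) - Complex.I * u)
    (x₀ := t) (s := Metric.ball t 1) (bound := fun u => (|t| + 1) * u ^ 2) (Metric.ball_mem_nhds _ one_pos)
    (Eventually.of_forall fun s => by fun_prop)
    (by
      refine (hν2.const_mul (3 * t ^ 2)).mono' (by fun_prop) (ae_of_all _ fun u => ?_)
      have := aux_bound2 (t * u)
      push_cast at this
      rw [← mul_assoc] at this
      refine this.trans (le_of_eq (by ring)))
    (by fun_prop)
    (ae_of_all _ fun u s hs => by
      refine (hb s u).trans ?_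
      have : |s| ≤ |t| + 1 := by
        have h1 : |s - t| < 1 := by simpa [Real.dist_eq] using hs
        have h2 := abs_sub_abs_le_abs_sub s t
        linarith
      gcongr) (hν2.const_mul _)
    (ae_of_all _ fun u s _ => by
      have h1 : HasDerivAt (fun s : ℝ => Complex.I * (s : ℂ) * u) (Complex.I * u) s := by
        have := ((Complex.ofRealCLM.hasDerivAt (x := s)).const_mul Complex.I).mul_const (u : ℂ)
        simpa using this
      exact ((hexpd s u).sub_const 1).sub h1))
  have h1 : HasDerivAt (fun s : ℝ => Complex.I * (s : ℂ) * μ) (Complex.I * μ) t := by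
    have := ((Complex.ofRealCLM.hasDerivAt (x := t)).const_mul Complex.I).mul_const (μ : ℂ)
    simpa using this
  have d3 := (h1.add d2.2).cexp
  have heq : (fun s : ℝ => ∫ x : ℝ, Complex.exp (Complex.I * s * x) ∂P) =
      fun s : ℝ => Complex.exp (Complex.I * s * μ
            + ∫ u : ℝ, (Complex.exp (Complex.I * s * u) - 1 - Complex.I * s * u) ∂ν) := funext hcf
  have d4 := d1.2
  rw [heq] at d4
  have e := d4.unique d3
  simp only [Pi.add_apply] at e
  rw [← hcf t] at e
  have e1 : ∫ x : ℝ, Complex.exp (Complex.I * t * x) * (Complex.I * x) ∂P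
      = Complex.I * ∫ x : ℝ, (x : ℂ) * Complex.exp (Complex.I * t * x) ∂P := by
    rw [← integral_const_mul]; congr 1; ext x; ring
  have e2 : ∫ u : ℝ, (Complex.exp (Complex.I * t * u) * (Complex.I * u) - Complex.I * u) ∂ν
      = Complex.I * ∫ u : ℝ, (u : ℂ) * (Complex.exp (Complex.I * t * u) - 1) ∂ν := by
    rw [← integral_const_mul]; congr 1; ext x; ring
  rw [e1, e2] at e
  have hxint : Integrable (fun x : ℝ => (x : ℂ) * Complex.exp (Complex.I * t * x)) P :=
    hP.abs.mono' (by fun_prop) (ae_of_all _ fun x => by simp [hnorm])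
  simp_rw [sub_mul]
  rw [integral_sub hxint (hexpint.const_mul _), integral_const_mul]
  have := mul_left_cancel₀ Complex.I_ne_zero (e.trans (b := _) (c := Complex.I * ((∫ x : ℝ, Complex.exp (Complex.I * t * x) ∂P) * (μ + ∫ u : ℝ, (u : ℂ) * (Complex.exp (Complex.I * t * u) - 1) ∂ν))) (by ring))
  rw [this]; ring

def Kset (a u : ℝ) : Set ℝ := Ico (min a (a - u)) (max a (a - u))

lemma mem_Kset (a u x : ℝ) : x ∈ Kset a u ↔ a ∈ uIoc x (x + u) := by
  unfold Kset
  rw [mem_uIoc, mem_Ico, min_le_iff, lt_max_iff]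
  grind

lemma measurableSet_Kset (a u : ℝ) : MeasurableSet (Kset a u) := measurableSet_Ico

lemma measurableSet_triple : MeasurableSet {p : (ℝ × ℝ) × ℝ | p.2 ∈ Kset p.1.1 p.1.2} := by
  have h1 : MeasurableSet {p : (ℝ × ℝ) × ℝ | min p.1.1 (p.1.1 - p.1.2) ≤ p.2} :=
    measurableSet_le (by fun_prop) (by fun_prop)
  have h2 : MeasurableSet {p : (ℝ × ℝ) × ℝ | p.2 < max p.1.1 (p.1.1 - p.1.2)} :=
    measurableSet_lt (by fun_prop) (by fun_prop)
  exact h1.inter h2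

lemma measurable_P_Kset (P : Measure ℝ) [IsProbabilityMeasure P] :
    Measurable (fun p : ℝ × ℝ => P (Kset p.1 p.2)) :=
  measurable_measure_prodMk_left measurableSet_triple

noncomputable def kfun (P ν : Measure ℝ) (a : ℝ) : ENNReal := ∫⁻ u, ‖u‖ₑ * P (Kset a u) ∂ν

noncomputable def hfun (P : Measure ℝ) (μ : ℝ) (a : ℝ) : ℝ := ∫ x in Ici a, (x - μ) ∂P

lemma measurable_kfun (P ν : Measure ℝ) [IsProbabilityMeasure P] [SFinite ν] :
    Measurable (kfun P ν) := by
  unfold kfun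
  have := measurable_P_Kset P
  exact Measurable.lintegral_prod_right' (f := fun p : ℝ × ℝ => ‖p.2‖ₑ * P (Kset p.1 p.2))
    ((by fun_prop : Measurable fun p : ℝ × ℝ => ‖p.2‖ₑ).mul this)

lemma cexp_interval (t x y : ℝ) :
    Complex.I * t * ∫ a in x..y, Complex.exp (Complex.I * t * a)
      = Complex.exp (Complex.I * t * y) - Complex.exp (Complex.I * t * x) := by
  rcases eq_or_ne t 0 with rfl | ht
  · simp
  · have : Complex.I * (t : ℂ) ≠ 0 := mul_ne_zero Complex.I_ne_zero (by exact_mod_cast ht)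
    rw [integral_exp_mul_complex this]
    exact mul_div_cancel₀ _ this

lemma norm_cexp_I (s x : ℝ) : ‖Complex.exp (Complex.I * s * x)‖ = 1 := by
  have : Complex.I * s * x = (s * x : ℝ) * Complex.I := by push_cast; ring
  rw [this, Complex.norm_exp_ofReal_mul_I]

/-- integrand for k -/
noncomputable def fk (t : ℝ) (a : ℝ) (p : ℝ × ℝ) : ℂ :=
  {q : (ℝ × ℝ) × ℝ | q.2 ∈ Kset q.1.1 q.1.2}.indicator
    (fun _ => ((|p.1| : ℝ) : ℂ) * Complex.exp (Complex.I * t * a)) ((a, p.1), p.2)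

lemma measurable_fk (t : ℝ) : Measurable (Function.uncurry (fk t)) := by
  unfold fk Function.uncurry
  have : Measurable (({q : (ℝ × ℝ) × ℝ | q.2 ∈ Kset q.1.1 q.1.2}.indicator
    (fun q => ((|q.1.2| : ℝ) : ℂ) * Complex.exp (Complex.I * t * q.1.1)))) :=
    Measurable.indicator (by fun_prop) measurableSet_triple
  exact this.comp (g := _) (f := fun p : ℝ × ℝ × ℝ => ((p.1, p.2.1), p.2.2)) (by fun_prop)

lemma fk_eq (t a : ℝ) (p : ℝ × ℝ) : fk t a p =
    (uIoc p.2 (p.2 + p.1)).indicator (fun a : ℝ => ((|p.1| : ℝ) : ℂ) * Complex.exp (Complex.I * t * a)) a := by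
  unfold fk
  by_cases h : p.2 ∈ Kset a p.1
  · rw [indicator_of_mem (show ((a, p.1), p.2) ∈ {q : (ℝ × ℝ) × ℝ | q.2 ∈ Kset q.1.1 q.1.2} from h),
      indicator_of_mem ((mem_Kset _ _ _).1 h)]
  · rw [indicator_of_notMem (show ((a, p.1), p.2) ∉ {q : (ℝ × ℝ) × ℝ | q.2 ∈ Kset q.1.1 q.1.2} from h),
      indicator_of_notMem (mt (mem_Kset _ _ _).2 h)]

lemma fk_eq' (t a : ℝ) (p : ℝ × ℝ) : fk t a p =
    Complex.exp (Complex.I * t * a) * ((Kset a p.1).indicator (fun _ => |p.1|) p.2 : ℝ) := by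
  unfold fk
  by_cases h : p.2 ∈ Kset a p.1
  · rw [indicator_of_mem (show ((a, p.1), p.2) ∈ {q : (ℝ × ℝ) × ℝ | q.2 ∈ Kset q.1.1 q.1.2} from h),
      indicator_of_mem h, mul_comm]
  · rw [indicator_of_notMem (show ((a, p.1), p.2) ∉ {q : (ℝ × ℝ) × ℝ | q.2 ∈ Kset q.1.1 q.1.2} from h),
      indicator_of_notMem h]
    simp

lemma fk_enorm (t a : ℝ) (p : ℝ × ℝ) : ‖fk t a p‖ₑ =
    (uIoc p.2 (p.2 + p.1)).indicator (fun _ : ℝ => ‖p.1‖ₑ) a := by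
  rw [fk_eq]
  simp only [indicator]
  split_ifs
  · rw [enorm_mul, ← ofReal_norm (Complex.exp _), norm_cexp_I]
    simp [← ofReal_norm]
  · simp

lemma fk_integrable (P ν : Measure ℝ) [IsProbabilityMeasure P] [SFinite ν]
    (hν2 : Integrable (fun u : ℝ => u ^ 2) ν) (t : ℝ) :
    Integrable (Function.uncurry (fk t)) (volume.prod (ν.prod P)) := by
  refine ⟨(measurable_fk t).aestronglyMeasurable, ?_⟩
  unfold HasFiniteIntegral
  rw [lintegral_prod_symm _ (measurable_fk t).enorm.aemeasurable]
  simp only [Function.uncurry_apply_pair, fk_enorm]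
  have : ∀ p : ℝ × ℝ, ∫⁻ a : ℝ, (uIoc p.2 (p.2 + p.1)).indicator (fun _ : ℝ => ‖p.1‖ₑ) a
      = ‖p.1 ^ 2‖ₑ := by
    intro p
    rw [lintegral_indicator measurableSet_uIoc, setLIntegral_const, Real.volume_uIoc]
    simp [← ofReal_norm, sq, ← ENNReal.ofReal_mul]
  simp_rw [this]
  rw [lintegral_prod _ (by fun_prop)]
  simpa [HasFiniteIntegral] using hν2.2

lemma kfun_lintegral (P ν : Measure ℝ) [IsProbabilityMeasure P] [SFinite ν] (t a : ℝ) :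
    ∫ p, fk t a p ∂(ν.prod P) = (kfun P ν a).toReal • Complex.exp (Complex.I * t * a) := by
  simp_rw [fk_eq']
  rw [integral_const_mul, integral_complex_ofReal, Complex.real_smul, mul_comm]
  congr 2
  have hm : Measurable (fun p : ℝ × ℝ => (Kset a p.1).indicator (fun _ => |p.1|) p.2) := by
    have : Measurable (({q : (ℝ × ℝ) × ℝ | q.2 ∈ Kset q.1.1 q.1.2}.indicator
      (fun q => |q.1.2|))) := Measurable.indicator (by fun_prop) measurableSet_triple
    exact this.comp (g := _) (f := fun p : ℝ × ℝ => ((a, p.1), p.2)) (by fun_prop)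
  rw [integral_eq_lintegral_of_nonneg_ae]
  · congr 1
    rw [lintegral_prod _ hm.ennreal_ofReal.aemeasurable]
    unfold kfun
    congr 1; ext u
    have : ∀ x, ENNReal.ofReal ((Kset a u).indicator (fun _ => |u|) x)
        = (Kset a u).indicator (fun _ => ‖u‖ₑ) x := by
      intro x
      simp only [indicator]
      split_ifs <;> simp [← ofReal_norm]
    simp_rw [this]
    rw [lintegral_indicator (measurableSet_Kset a u), setLIntegral_const]
  · exact ae_of_all _ fun p => indicator_nonneg (fun _ _ => abs_nonneg _) _
  · exact hm.aestronglyMeasurable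

lemma kfun_fourier (P ν : Measure ℝ) [IsProbabilityMeasure P] [SFinite ν]
    (hν2 : Integrable (fun u : ℝ => u ^ 2) ν) (t : ℝ) :
    Complex.I * t * ∫ a : ℝ, (kfun P ν a).toReal • Complex.exp (Complex.I * t * a)
      = (∫ x : ℝ, Complex.exp (Complex.I * t * x) ∂P) *
        ∫ u : ℝ, (u : ℂ) * (Complex.exp (Complex.I * t * u) - 1) ∂ν := by
  simp_rw [← kfun_lintegral]
  rw [integral_integral_swap (fk_integrable P ν hν2 t), ← integral_const_mul,
    mul_comm (∫ x : ℝ, Complex.exp (Complex.I * t * x) ∂P),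
    ← integral_prod_mul]
  congr 1; ext p
  rw [show (fun a : ℝ => fk t a p) = fun a => (uIoc p.2 (p.2 + p.1)).indicator
    (fun a : ℝ => ((|p.1| : ℝ) : ℂ) * Complex.exp (Complex.I * t * a)) a from
      funext fun a => fk_eq t a p]
  rw [integral_indicator measurableSet_uIoc, integral_const_mul]
  have h : ((|p.1| : ℝ) : ℂ) * ∫ a in uIoc p.2 (p.2 + p.1), Complex.exp (Complex.I * t * a)
      = p.1 * ∫ a in p.2..(p.2 + p.1), Complex.exp (Complex.I * t * a) := by
    rcases le_total 0 p.1 with h | h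
    · rw [intervalIntegral.integral_of_le (by linarith), uIoc_of_le (by linarith), abs_of_nonneg h]
    · rw [intervalIntegral.integral_of_ge (by linarith), uIoc_of_ge (by linarith), abs_of_nonpos h]
      push_cast; ring
  rw [h]
  have h2 := cexp_interval t p.2 (p.2 + p.1)
  calc _ = (p.1 : ℂ) * (Complex.I * t * ∫ a in p.2..(p.2 + p.1), Complex.exp (Complex.I * t * a)) := by ring
    _ = _ := by
      rw [h2]
      have : Complex.exp (Complex.I * t * ((p.2 + p.1 : ℝ) : ℂ))
        = Complex.exp (Complex.I * t * p.1) * Complex.exp (Complex.I * t * p.2) := by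
        rw [← Complex.exp_add]; congr 1; push_cast; ring
      rw [this]; ring

lemma kfun_lt_top (P ν : Measure ℝ) [IsProbabilityMeasure P] [SFinite ν]
    (hν2 : Integrable (fun u : ℝ => u ^ 2) ν) : ∫⁻ a, kfun P ν a < ⊤ := by
  have h := (fk_integrable P ν hν2 0).2
  unfold HasFiniteIntegral at h
  rw [lintegral_prod _ (measurable_fk 0).enorm.aemeasurable] at h
  refine lt_of_le_of_lt (le_of_eq ?_) h
  congr 1; ext a
  rw [lintegral_prod _ (by
    have := ((measurable_fk 0).comp (measurable_prodMk_left (x := a))).enorm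
    exact this.aemeasurable)]
  unfold kfun
  congr 1; ext u
  have : ∀ x, ‖Function.uncurry (fk 0) (a, u, x)‖ₑ = (Kset a u).indicator (fun _ => ‖u‖ₑ) x := by
    intro x
    rw [Function.uncurry_apply_pair, fk_enorm]
    by_cases h : x ∈ Kset a u
    · rw [indicator_of_mem h, indicator_of_mem ((mem_Kset _ _ _).1 h)]
    · rw [indicator_of_notMem h, indicator_of_notMem (mt (mem_Kset _ _ _).2 h)]
  simp_rw [this]
  rw [lintegral_indicator (measurableSet_Kset a u), setLIntegral_const]

/-- integrand for h -/
noncomputable def fh (μ t : ℝ) (a x : ℝ) : ℂ :=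
  (Complex.exp (Complex.I * t * a)) *
    (((x - μ) * ((Ioc 0 x).indicator 1 a - (Ioc x 0).indicator 1 a) : ℝ) : ℂ)

lemma measurable_fh (μ t : ℝ) : Measurable (Function.uncurry (fh μ t)) := by
  unfold fh Function.uncurry
  have h1 : Measurable (fun p : ℝ × ℝ => (Ioc 0 p.2).indicator (1 : ℝ → ℝ) p.1) := by
    have : MeasurableSet ({p : ℝ × ℝ | 0 < p.1} ∩ {p : ℝ × ℝ | p.1 ≤ p.2}) :=
      (measurableSet_lt (by fun_prop) (by fun_prop)).inter (measurableSet_le (by fun_prop) (by fun_prop))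
    exact (measurable_const (a := (1 : ℝ))).indicator this
  have h2 : Measurable (fun p : ℝ × ℝ => (Ioc p.2 0).indicator (1 : ℝ → ℝ) p.1) := by
    have : MeasurableSet ({p : ℝ × ℝ | p.2 < p.1} ∩ {p : ℝ × ℝ | p.1 ≤ 0}) :=
      (measurableSet_lt (by fun_prop) (by fun_prop)).inter (measurableSet_le (by fun_prop) (by fun_prop))
    exact (measurable_const (a := (1 : ℝ))).indicator this
  fun_prop

lemma fh_enorm (μ t a x : ℝ) : ‖fh μ t a x‖ₑ = (uIoc 0 x).indicator (fun _ => ‖x - μ‖ₑ) a := by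
  unfold fh
  rw [enorm_mul, ← ofReal_norm (Complex.exp _), norm_cexp_I]
  simp only [indicator, mem_uIoc, mem_Ioc, Pi.one_apply]
  have : ∀ y : ℝ, ‖(y : ℂ)‖ₑ = ‖y‖ₑ := fun y => by simp [← ofReal_norm]
  rw [this]
  by_cases h1 : 0 < a ∧ a ≤ x <;> by_cases h2 : x < a ∧ a ≤ 0
  · exfalso; linarith [h1.1, h2.2]
  all_goals simp [h1, h2, enorm_sub_rev]

lemma fh_integrable (P : Measure ℝ) [IsProbabilityMeasure P] (μ t : ℝ)
    (h2 : Integrable (fun x : ℝ => (x - μ) * x) P) :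
    Integrable (Function.uncurry (fh μ t)) (volume.prod P) := by
  refine ⟨(measurable_fh μ t).aestronglyMeasurable, ?_⟩
  unfold HasFiniteIntegral
  rw [lintegral_prod_symm _ (measurable_fh μ t).enorm.aemeasurable]
  simp only [Function.uncurry_apply_pair, fh_enorm]
  have : ∀ x : ℝ, ∫⁻ a : ℝ, (uIoc 0 x).indicator (fun _ : ℝ => ‖x - μ‖ₑ) a
      = ‖(x - μ) * x‖ₑ := by
    intro p
    rw [lintegral_indicator measurableSet_uIoc, setLIntegral_const, Real.volume_uIoc]
    simp [← ofReal_norm, ENNReal.ofReal_mul]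
  simp_rw [this]
  exact h2.2

lemma hfun_eq (P : Measure ℝ) [IsProbabilityMeasure P] (μ t : ℝ)
    (hP : Integrable (fun x : ℝ => x) P) (hμ : ∫ x, x ∂P = μ) (a : ℝ) :
    ∫ x, fh μ t a x ∂P = hfun P μ a • Complex.exp (Complex.I * t * a) := by
  unfold fh
  rw [integral_const_mul, integral_complex_ofReal, Complex.real_smul, mul_comm]
  congr 2
  have hPμ : Integrable (fun x : ℝ => x - μ) P := hP.sub (integrable_const _)
  have h0 : ∫ x, (x - μ) ∂P = 0 := by
    rw [integral_sub hP (integrable_const _), hμ]; simp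
  have : ∀ x : ℝ, (x - μ) * ((Ioc 0 x).indicator 1 a - (Ioc x 0).indicator 1 a)
      = (Ici a).indicator (fun x => x - μ) x - (Ici a).indicator 1 0 * (x - μ) := by
    intro x
    simp only [indicator, mem_Ioc, mem_Ici, Pi.one_apply]
    rcases le_or_gt a x with h1 | h1 <;> rcases le_or_gt a 0 with h2 | h2 <;>
      simp [h1, h2, not_le.2, not_lt.2]
  simp_rw [this]
  rw [integral_sub (hPμ.indicator measurableSet_Ici) (hPμ.const_mul _), integral_const_mul, h0,
    integral_indicator measurableSet_Ici]
  simp [hfun]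

lemma hfun_fourier (P : Measure ℝ) [IsProbabilityMeasure P] (μ t : ℝ)
    (hP : Integrable (fun x : ℝ => x) P) (hμ : ∫ x, x ∂P = μ)
    (h2 : Integrable (fun x : ℝ => (x - μ) * x) P) :
    Complex.I * t * ∫ a : ℝ, hfun P μ a • Complex.exp (Complex.I * t * a)
      = ∫ x : ℝ, ((x : ℂ) - μ) * Complex.exp (Complex.I * t * x) ∂P := by
  have hPμ : Integrable (fun x : ℝ => ((x - μ : ℝ) : ℂ)) P := (hP.sub (integrable_const _)).ofReal
  have h0 : ∫ x : ℝ, ((x - μ : ℝ) : ℂ) ∂P = 0 := by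
    rw [integral_complex_ofReal, integral_sub hP (integrable_const _), hμ]; simp
  simp_rw [← hfun_eq P μ t hP hμ]
  rw [integral_integral_swap (fh_integrable P μ t h2), ← integral_const_mul]
  have : ∀ x : ℝ, Complex.I * t * ∫ a, fh μ t a x
      = ((x : ℂ) - μ) * Complex.exp (Complex.I * t * x) - ((x - μ : ℝ) : ℂ) := by
    intro x
    have e : ∀ a, fh μ t a x = ((x - μ : ℝ) : ℂ) * ((Ioc 0 x).indicator (fun a : ℝ => Complex.exp (Complex.I * t * a)) a
        - (Ioc x 0).indicator (fun a : ℝ => Complex.exp (Complex.I * t * a)) a) := by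
      intro a
      unfold fh
      simp only [indicator]
      split_ifs <;> simp <;> ring
    have hc : Continuous (fun a : ℝ => Complex.exp (Complex.I * t * a)) := by fun_prop
    simp_rw [e]
    rw [integral_const_mul, integral_sub, integral_indicator measurableSet_Ioc,
      integral_indicator measurableSet_Ioc]
    · have h3 := cexp_interval t 0 x
      unfold intervalIntegral at h3
      rw [mul_left_comm, h3]
      simp; ring
    · exact (integrable_indicator_iff measurableSet_Ioc).2 (hc.integrableOn_Ioc)
    · exact (integrable_indicator_iff measurableSet_Ioc).2 (hc.integrableOn_Ioc)
  simp_rw [this]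
  rw [integral_sub _ hPμ, h0, sub_zero]
  refine hPμ.norm.mono' (by fun_prop) (ae_of_all _ fun x => ?_)
  rw [norm_mul, norm_cexp_I]; simp

lemma hfun_integrable (P : Measure ℝ) [IsProbabilityMeasure P] (μ : ℝ)
    (hP : Integrable (fun x : ℝ => x) P) (hμ : ∫ x, x ∂P = μ)
    (h2 : Integrable (fun x : ℝ => (x - μ) * x) P) : Integrable (hfun P μ) := by
  have := (fh_integrable P μ 0 h2).integral_prod_left
  simp only [Function.uncurry_apply_pair, hfun_eq P μ 0 hP hμ] at this
  simpa using this.re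

lemma hfun_nonneg (P : Measure ℝ) [IsProbabilityMeasure P] (μ : ℝ)
    (hP : Integrable (fun x : ℝ => x) P) (hμ : ∫ x, x ∂P = μ) (a : ℝ) : 0 ≤ hfun P μ a := by
  have hPμ : Integrable (fun x : ℝ => x - μ) P := hP.sub (integrable_const _)
  have h0 : ∫ x, (x - μ) ∂P = 0 := by
    rw [integral_sub hP (integrable_const _), hμ]; simp
  unfold hfun
  rcases le_total μ a with h | h
  · exact setIntegral_nonneg measurableSet_Ici fun x hx => by
      have : a ≤ x := hx
      linarith
  · have h1 := integral_add_compl (measurableSet_Ici (a := a)) hPμ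
    have h2 : ∫ x in (Ici a)ᶜ, (x - μ) ∂P ≤ 0 :=
      setIntegral_nonpos measurableSet_Ici.compl fun x hx => by
        have : x < a := by simpa using hx
        linarith
    linarith

lemma hfun_ae_eq_kfun (P : Measure ℝ) [IsProbabilityMeasure P] (μ : ℝ) (ν : Measure ℝ) [SFinite ν]
    (hP : Integrable (fun x : ℝ => x) P) (hμ : ∫ x, x ∂P = μ)
    (hν2 : Integrable (fun u : ℝ => u ^ 2) ν)
    (hcf : ∀ t : ℝ,
      ∫ x : ℝ, Complex.exp (Complex.I * t * x) ∂P
        = Complex.exp (Complex.I * t * μ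
            + ∫ u : ℝ, (Complex.exp (Complex.I * t * u) - 1 - Complex.I * t * u) ∂ν)) :
    ∀ᵐ a : ℝ, ENNReal.ofReal (hfun P μ a) = kfun P ν a := by
  have hPμ : Integrable (fun x : ℝ => x - μ) P := hP.sub (integrable_const _)
  have h2 : Integrable (fun x : ℝ => (x - μ) * x) P := by
    have := (aux_L2 P μ ν hν2 hcf).add (hPμ.const_mul μ)
    refine this.congr (ae_of_all _ fun x => ?_)
    simp only [Pi.add_apply]; ring
  have hhi := hfun_integrable P μ hP hμ h2
  have hhn := hfun_nonneg P μ hP hμ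
  have hm := measurable_kfun P ν
  have hk := kfun_lt_top P ν hν2
  let m1 : Measure ℝ := volume.withDensity (fun a => ENNReal.ofReal (hfun P μ a))
  let m2 : Measure ℝ := volume.withDensity (kfun P ν)
  have : IsFiniteMeasure m1 := isFiniteMeasure_withDensity_ofReal hhi.2
  have : IsFiniteMeasure m2 := isFiniteMeasure_withDensity hk.ne
  have c1 : ∀ t : ℝ, charFun m1 t = ∫ a : ℝ, hfun P μ a • Complex.exp (Complex.I * t * a) := by
    intro t
    rw [charFun_apply_real]
    rw [integral_withDensity_eq_integral_toReal_smul₀ hhi.aemeasurable.ennreal_ofReal (by simp)]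
    congr 1; ext a
    rw [ENNReal.toReal_ofReal (hhn a)]
    congr 2; ring
  have c2 : ∀ t : ℝ, charFun m2 t = ∫ a : ℝ, (kfun P ν a).toReal • Complex.exp (Complex.I * t * a) := by
    intro t
    rw [charFun_apply_real]
    rw [integral_withDensity_eq_integral_toReal_smul hm (ae_lt_top hm hk.ne)]
    congr 1; ext a
    congr 2; ring
  have hch : charFun m1 = charFun m2 := by
    refine Continuous.ext_on (dense_compl_singleton (0 : ℝ)) continuous_charFun continuous_charFun ?_
    intro t ht
    have : Complex.I * (t : ℂ) ≠ 0 := mul_ne_zero Complex.I_ne_zero (by exact_mod_cast ht)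
    apply mul_left_cancel₀ this
    rw [c1, c2, hfun_fourier P μ t hP hμ h2, kfun_fourier P ν hν2 t,
      aux_deriv P μ ν hP hν2 hcf t]
  have heq : m1 = m2 := Measure.ext_of_charFun hch
  have := (withDensity_eq_iff hhi.aemeasurable.ennreal_ofReal hm.aemeasurable (by
    rw [← ofReal_integral_eq_lintegral_ofReal hhi (ae_of_all _ hhn)]; simp)).1 heq
  exact this

noncomputable def Dm (P : Measure ℝ) : Measure ℝ := (P.prod P).map (fun p => p.2 - p.1)

instance (P : Measure ℝ) [IsProbabilityMeasure P] : IsProbabilityMeasure (Dm P) := by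
  unfold Dm
  exact Measure.isProbabilityMeasure_map (by fun_prop)

lemma Dm_apply (P : Measure ℝ) [IsProbabilityMeasure P] {S : Set ℝ} (hS : MeasurableSet S) :
    Dm P S = ∫⁻ a, P ((fun x => x - a) ⁻¹' S) ∂P := by
  unfold Dm
  rw [Measure.map_apply (by fun_prop) hS,
    Measure.prod_apply ((by fun_prop : Measurable fun p : ℝ × ℝ => p.2 - p.1) hS)]
  rfl

lemma Kset_shift (a y u : ℝ) : (fun x => x - a) ⁻¹' (Kset y u) = Kset (a + y) u := by
  ext x
  rw [mem_preimage, mem_Kset, mem_Kset, mem_uIoc, mem_uIoc]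
  grind

lemma Dm_Kset (P : Measure ℝ) [IsProbabilityMeasure P] (y u : ℝ) :
    Dm P (Kset y u) = ∫⁻ a, P (Kset (a + y) u) ∂P := by
  rw [Dm_apply P (measurableSet_Kset y u)]
  simp_rw [Kset_shift]

lemma Dm_symm (P : Measure ℝ) [IsProbabilityMeasure P] {S : Set ℝ} (hS : MeasurableSet S) :
    Dm P ((fun x => -x) ⁻¹' S) = Dm P S := by
  unfold Dm
  have hm : Measurable fun p : ℝ × ℝ => p.2 - p.1 := by fun_prop
  rw [Measure.map_apply hm (measurable_neg hS), Measure.map_apply hm hS]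
  conv_lhs => rw [← Measure.prod_swap]
  rw [Measure.map_apply measurable_swap (hm (measurable_neg hS))]
  congr 1
  ext p
  simp [Prod.swap]

lemma tri (P : Measure ℝ) [IsProbabilityMeasure P] (w z : ℝ) :
    ∫⁻ s, P (Ico s (s + w)) * P (Ico (s + z) (s + z + w))
      = ∫⁻ p, ENNReal.ofReal (min p.1 (p.2 - z) - max (p.1 - w) (p.2 - z - w)) ∂(P.prod P) := by
  let T : Set (ℝ × (ℝ × ℝ)) :=
    ({q | q.1 ≤ q.2.1} ∩ {q | q.2.1 < q.1 + w}) ∩ ({q | q.1 + z ≤ q.2.2} ∩ {q | q.2.2 < q.1 + z + w})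
  have hT : MeasurableSet T :=
    ((measurableSet_le (by fun_prop) (by fun_prop)).inter
      (measurableSet_lt (by fun_prop) (by fun_prop))).inter
    ((measurableSet_le (by fun_prop) (by fun_prop)).inter
      (measurableSet_lt (by fun_prop) (by fun_prop)))
  have h1 : ∀ s, P (Ico s (s + w)) * P (Ico (s + z) (s + z + w)) = (P.prod P) (Prod.mk s ⁻¹' T) := by
    intro s
    rw [← Measure.prod_prod]
    rfl
  have h2 : ∀ p : ℝ × ℝ, ENNReal.ofReal (min p.1 (p.2 - z) - max (p.1 - w) (p.2 - z - w))
      = volume ((fun s => (s, p)) ⁻¹' T) := by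
    intro p
    rw [← Real.volume_Ioc]
    congr 1
    ext s
    simp only [T, mem_Ioc, mem_preimage, mem_inter_iff, mem_ofPred_eq, max_lt_iff, le_min_iff]
    grind
  simp_rw [h1, h2]
  rw [← Measure.prod_apply hT, Measure.prod_apply_symm hT]

lemma conc (P : Measure ℝ) [IsProbabilityMeasure P] (w z : ℝ) (hw : 0 < w) :
    Dm P (Ico (z - w / 2) (z + w / 2)) ≤ 4 * Dm P (Ioo (-w) w) := by
  have hm : Measurable fun p : ℝ × ℝ => p.2 - p.1 := by fun_prop
  let g : ℝ → ENNReal := fun s => P (Ico s (s + w))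
  have hg : Measurable g := by
    have hT : MeasurableSet ({q : ℝ × ℝ | q.1 ≤ q.2} ∩ {q | q.2 < q.1 + w}) :=
      (measurableSet_le (by fun_prop) (by fun_prop)).inter
        (measurableSet_lt (by fun_prop) (by fun_prop))
    exact measurable_measure_prodMk_left hT
  have low : ENNReal.ofReal (w / 2) * Dm P (Ico (z - w / 2) (z + w / 2)) ≤ ∫⁻ s, g s * g (s + z) := by
    rw [tri]
    unfold Dm
    rw [Measure.map_apply hm measurableSet_Ico, ← setLIntegral_const,
      ← lintegral_indicator (hm measurableSet_Ico)]
    refine lintegral_mono fun p => ?_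
    refine indicator_le' (g := fun p : ℝ × ℝ => ENNReal.ofReal (min p.1 (p.2 - z) - max (p.1 - w) (p.2 - z - w))) ?_ ?_ p
    · intro p hp
      refine ENNReal.ofReal_le_ofReal ?_
      have hp : z - w / 2 ≤ p.2 - p.1 ∧ p.2 - p.1 < z + w / 2 := hp
      rw [le_sub_iff_add_le', le_min_iff, ← le_sub_iff_add_le, ← le_sub_iff_add_le, max_le_iff, max_le_iff]
      grind
    · intro p _; exact zero_le
  have mid : ∫⁻ s, g s * g (s + z) ≤ 2 * ∫⁻ s, g s * g (s + 0) := by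
    calc ∫⁻ s, g s * g (s + z) ≤ ∫⁻ s, (g s * g s + g (s + z) * g (s + z)) := by
          refine lintegral_mono fun s => ?_
          rcases le_total (g s) (g (s + z)) with h | h
          · exact (mul_le_mul_left h _).trans le_add_self
          · exact (mul_le_mul_right h _).trans le_self_add
      _ = 2 * ∫⁻ s, g s * g (s + 0) := by
          rw [lintegral_add_left (by fun_prop),
            lintegral_add_right_eq_self (fun s => g s * g s) z, two_mul]
          simp
  have up : ∫⁻ s, g s * g (s + 0) ≤ ENNReal.ofReal w * Dm P (Ioo (-w) w) := by
    rw [tri]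
    unfold Dm
    rw [Measure.map_apply hm measurableSet_Ioo, ← setLIntegral_const,
      ← lintegral_indicator (hm measurableSet_Ioo)]
    refine lintegral_mono fun p => ?_
    by_cases hp : p ∈ (fun p : ℝ × ℝ => p.2 - p.1) ⁻¹' Ioo (-w) w
    · rw [indicator_of_mem hp]
      refine ENNReal.ofReal_le_ofReal ?_
      have := min_le_left p.1 (p.2 - 0)
      have := le_max_left (p.1 - w) (p.2 - 0 - w)
      linarith
    · rw [indicator_of_notMem hp]
      have hp : ¬ (-w < p.2 - p.1 ∧ p.2 - p.1 < w) := hp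
      rw [nonpos_iff_eq_zero, ENNReal.ofReal_eq_zero]
      grind
  have h := low.trans (mid.trans (mul_le_mul_right up 2))
  have e : (2 : ENNReal) * (ENNReal.ofReal w * Dm P (Ioo (-w) w))
      = ENNReal.ofReal (w / 2) * (4 * Dm P (Ioo (-w) w)) := by
    have : ENNReal.ofReal w = ENNReal.ofReal (w / 2) * 2 := by
      rw [show (2 : ENNReal) = ENNReal.ofReal 2 by simp, ← ENNReal.ofReal_mul (by positivity)]
      congr 1; ring
    rw [this]; ring
  rw [e] at h
  exact (ENNReal.mul_le_mul_iff_right (by simpa using hw) (by simp)).1 h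

noncomputable def Bf (P : Measure ℝ) (u : ℝ) : ENNReal := Dm P (Ioo (-(|u| / 2)) (|u| / 2))

lemma Kset_le (P : Measure ℝ) [IsProbabilityMeasure P] (y u : ℝ) (hu : u ≠ 0) :
    Dm P (Kset y u) ≤ 8 * Bf P u := by
  set w := |u| / 2 with hw
  have hw0 : 0 < w := by positivity
  have hsub : Kset y u ⊆ Ico ((y - u / 2 - w / 2) - w / 2) ((y - u / 2 - w / 2) + w / 2)
      ∪ Ico ((y - u / 2 + w / 2) - w / 2) ((y - u / 2 + w / 2) + w / 2) := by
    intro x hx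
    rw [mem_Kset, mem_uIoc] at hx
    rw [mem_union, mem_Ico, mem_Ico]
    rcases abs_cases u with ⟨h, _⟩ | ⟨h, _⟩ <;> rw [h] at hw <;> grind
  calc Dm P (Kset y u) ≤ _ := measure_mono hsub
    _ ≤ _ := measure_union_le _ _
    _ ≤ 4 * Dm P (Ioo (-w) w) + 4 * Dm P (Ioo (-w) w) := add_le_add (conc P w _ hw0) (conc P w _ hw0)
    _ = 8 * Bf P u := by unfold Bf; rw [← hw]; ring

lemma Bf_le_pos (P : Measure ℝ) [IsProbabilityMeasure P] (y u : ℝ) (hy : 0 < y) (hyu : y < u / 2) :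
    Bf P u ≤ 2 * Dm P (Kset y u) := by
  have hu : 0 < u := by linarith
  unfold Bf
  rw [abs_of_pos hu]
  have hsub : Ioo (-(u / 2)) (u / 2) ⊆ Kset y u ∪ (fun x => -x) ⁻¹' (Kset y u) := by
    intro x hx
    rw [mem_union, mem_preimage, mem_Kset, mem_Kset, mem_uIoc, mem_uIoc]
    rw [mem_Ioo] at hx
    grind
  calc _ ≤ _ := measure_mono hsub
    _ ≤ _ := measure_union_le _ _
    _ = _ := by rw [Dm_symm P (measurableSet_Kset y u), two_mul]

lemma Bf_le_neg (P : Measure ℝ) [IsProbabilityMeasure P] (y u : ℝ) (hy : y < 0) (hyu : u / 2 < y) :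
    Bf P u ≤ 2 * Dm P (Kset y u) := by
  have hu : u < 0 := by linarith
  unfold Bf
  rw [abs_of_neg hu]
  have hsub : Ioo (-(-u / 2)) (-u / 2) ⊆ Kset y u ∪ (fun x => -x) ⁻¹' (Kset y u) := by
    intro x hx
    rw [mem_union, mem_preimage, mem_Kset, mem_Kset, mem_uIoc, mem_uIoc]
    rw [mem_Ioo] at hx
    grind
  calc _ ≤ _ := measure_mono hsub
    _ ≤ _ := measure_union_le _ _
    _ = _ := by rw [Dm_symm P (measurableSet_Kset y u), two_mul]

lemma measurable_hfun (P : Measure ℝ) [IsProbabilityMeasure P] (μ : ℝ) : Measurable (hfun P μ) := by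
  have hs : MeasurableSet {p : ℝ × ℝ | p.1 ≤ p.2} := measurableSet_le (by fun_prop) (by fun_prop)
  have h1 : StronglyMeasurable ({p : ℝ × ℝ | p.1 ≤ p.2}.indicator (fun p : ℝ × ℝ => p.2 - μ)) :=
    ((by fun_prop : Measurable fun p : ℝ × ℝ => p.2 - μ).indicator hs).stronglyMeasurable
  have h2 := (h1.integral_prod_right' (ν := P)).measurable
  have : hfun P μ = fun a => ∫ x, {p : ℝ × ℝ | p.1 ≤ p.2}.indicator (fun p : ℝ × ℝ => p.2 - μ) (a, x) ∂P := by
    ext a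
    unfold hfun
    rw [← integral_indicator measurableSet_Ici]
    rfl
  rw [this]; exact h2

lemma hfun_le (P : Measure ℝ) [IsProbabilityMeasure P] (μ : ℝ)
    (hP : Integrable (fun x : ℝ => x) P) (a : ℝ) : hfun P μ a ≤ ∫ x, |x - μ| ∂P := by
  have hPμ : Integrable (fun x : ℝ => x - μ) P := hP.sub (integrable_const _)
  unfold hfun
  refine (le_abs_self _).trans (abs_integral_le_integral_abs.trans ?_)
  exact setIntegral_le_integral hPμ.abs (ae_of_all _ fun x => abs_nonneg _)

lemma hfun_tendsto (P : Measure ℝ) [IsProbabilityMeasure P] (μ : ℝ)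
    (hP : Integrable (fun x : ℝ => x) P) (a : ℝ) (q : ℕ → ℝ) (hq : ∀ n, q n < 0)
    (hq0 : Tendsto q atTop (𝓝 0)) :
    Tendsto (fun n => hfun P μ (a + q n)) atTop (𝓝 (hfun P μ a)) := by
  have hPμ : Integrable (fun x : ℝ => x - μ) P := hP.sub (integrable_const _)
  unfold hfun
  simp_rw [← integral_indicator measurableSet_Ici]
  refine tendsto_integral_of_dominated_convergence (fun x => |x - μ|)
    (fun n => (hPμ.indicator measurableSet_Ici).aestronglyMeasurable) hPμ.abs
    (fun n => ae_of_all _ fun x => ?_) (ae_of_all _ fun x => ?_)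
  · exact norm_indicator_le_norm_self (fun x => x - μ) x
  · refine tendsto_const_nhds.congr' ?_
    rcases le_or_gt a x with h | h
    · refine Eventually.of_forall fun n => ?_
      have : a + q n ≤ x := by linarith [hq n]
      simp [indicator, h, this]
    · have : ∀ᶠ n in atTop, x - a < q n := hq0.eventually_const_lt (by linarith)
      filter_upwards [this] with n hn
      simp [indicator, not_le.2 h, not_le.2 (show x < a + q n by linarith)]

lemma Kset_tendsto (D : Measure ℝ) [IsFiniteMeasure D] (u : ℝ) (q : ℕ → ℝ) (hq : ∀ n, q n < 0)
    (hq0 : Tendsto q atTop (𝓝 0)) :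
    Tendsto (fun n => D (Kset (q n) u)) atTop (𝓝 (D (Kset 0 u))) := by
  refine tendsto_measure_of_tendsto_indicator_of_isFiniteMeasure atTop D
    (fun n => measurableSet_Kset _ _) fun x => ?_
  have h1 : ∀ᶠ n in atTop, x < 0 → x < q n := by
    rcases le_or_gt 0 x with h | h
    · exact Eventually.of_forall fun n hn => by linarith
    · filter_upwards [hq0.eventually_const_lt h] with n hn _ using hn
  have h2 : ∀ᶠ n in atTop, x + u < 0 → x + u < q n := by
    rcases le_or_gt 0 (x + u) with h | h
    · exact Eventually.of_forall fun n hn => by linarith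
    · filter_upwards [hq0.eventually_const_lt h] with n hn _ using hn
  filter_upwards [h1, h2] with n h1 h2
  have := hq n
  rw [mem_Kset, mem_Kset, mem_uIoc, mem_uIoc]
  grind

lemma measurable_Dm_Kset (P : Measure ℝ) [IsProbabilityMeasure P] (y : ℝ) :
    Measurable (fun u : ℝ => ‖u‖ₑ * Dm P (Kset y u)) := by
  have h : Measurable (fun u : ℝ => Dm P (Kset y u)) :=
    (measurable_P_Kset (Dm P)).comp (measurable_prodMk_left (x := y))
  fun_prop

lemma K_swap (P ν : Measure ℝ) [IsProbabilityMeasure P] [SFinite ν] (y : ℝ) :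
    ∫⁻ a, kfun P ν (a + y) ∂P = ∫⁻ u, ‖u‖ₑ * Dm P (Kset y u) ∂ν := by
  unfold kfun
  have hm : Measurable (fun p : ℝ × ℝ => P (Kset (p.1 + y) p.2)) :=
    (measurable_P_Kset P).comp (by fun_prop : Measurable fun p : ℝ × ℝ => (p.1 + y, p.2))
  rw [lintegral_lintegral_swap]
  · congr 1; ext u
    rw [lintegral_const_mul, Dm_Kset]
    exact hm.comp (measurable_prodMk_right (y := u))
  · apply Measurable.aemeasurable
    exact (by fun_prop : Measurable fun p : ℝ × ℝ => ‖p.2‖ₑ).mul hm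

lemma main_eq (P : Measure ℝ) [IsProbabilityMeasure P] (μ : ℝ) (ν : Measure ℝ) [SFinite ν]
    (hP : Integrable (fun x : ℝ => x) P)
    (hae : ∀ᵐ a : ℝ, ENNReal.ofReal (hfun P μ a) = kfun P ν a) :
    ∫⁻ a, ENNReal.ofReal (hfun P μ a) ∂P = ∫⁻ u, ‖u‖ₑ * Dm P (Kset 0 u) ∂ν := by
  set M : ENNReal := ENNReal.ofReal (∫ x, |x - μ| ∂P) with hM
  let K : ℝ → ENNReal := fun y => ∫⁻ u, ‖u‖ₑ * Dm P (Kset y u) ∂ν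
  let H : ℝ → ENNReal := fun y => ∫⁻ a, ENNReal.ofReal (hfun P μ (a + y)) ∂P
  have hHM : ∀ y, H y ≤ M := by
    intro y
    calc H y ≤ ∫⁻ _, M ∂P := lintegral_mono fun a => ENNReal.ofReal_le_ofReal (hfun_le P μ hP _)
      _ = M := by simp
  have hgood : ∀ᵐ y : ℝ, H y = K y := by
    have h1 : ∀ᵐ p : ℝ × ℝ ∂(P.prod volume),
        ENNReal.ofReal (hfun P μ (p.1 + p.2)) = kfun P ν (p.1 + p.2) := by
      have hs : MeasurableSet {p : ℝ × ℝ |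
          ENNReal.ofReal (hfun P μ (p.1 + p.2)) = kfun P ν (p.1 + p.2)} := by
        have h1 := measurable_hfun P μ
        have h2 := measurable_kfun P ν
        exact measurableSet_eq_fun (by fun_prop) (by fun_prop)
      rw [Measure.ae_prod_iff_ae_ae hs]
      refine ae_of_all _ fun a => ?_
      exact (measurePreserving_add_left volume a).quasiMeasurePreserving.ae hae
    have h2 : ∀ᵐ p : ℝ × ℝ ∂((volume : Measure ℝ).prod P),
        ENNReal.ofReal (hfun P μ (p.2 + p.1)) = kfun P ν (p.2 + p.1) :=
      (Measure.measurePreserving_swap).quasiMeasurePreserving.ae h1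
    filter_upwards [Measure.ae_ae_of_ae_prod h2] with y hy
    show ∫⁻ a, ENNReal.ofReal (hfun P μ (a + y)) ∂P = ∫⁻ u, ‖u‖ₑ * Dm P (Kset y u) ∂ν
    rw [← K_swap]
    exact lintegral_congr_ae hy
  have hdense : Dense {y : ℝ | H y = K y} := Measure.dense_of_ae hgood
  have hp : ∀ n : ℕ, ∃ z ∈ {y : ℝ | H y = K y}, z ∈ Ioo (0 : ℝ) (1 / ((n : ℝ) + 1)) :=
    fun n => hdense.exists_between (by positivity)
  have hq : ∀ n : ℕ, ∃ z ∈ {y : ℝ | H y = K y}, z ∈ Ioo (-(1 / ((n : ℝ) + 1))) (0 : ℝ) :=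
    fun n => hdense.exists_between (by
      have : 0 < 1 / ((n : ℝ) + 1) := by positivity
      linarith)
  choose p hpg hpI using hp
  choose q hqg hqI using hq
  have ht : Tendsto (fun n : ℕ => 1 / ((n : ℝ) + 1)) atTop (𝓝 0) := tendsto_one_div_add_atTop_nhds_zero_nat
  have hp0 : Tendsto p atTop (𝓝 0) :=
    squeeze_zero (fun n => (hpI n).1.le) (fun n => (hpI n).2.le) ht
  have hq0 : Tendsto q atTop (𝓝 0) := by
    refine tendsto_of_tendsto_of_tendsto_of_le_of_le (by simpa using ht.neg) tendsto_const_nhds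
      (fun n => (hqI n).1.le) (fun n => (hqI n).2.le)
  have hBm : ∀ n, Measurable (fun u : ℝ => 2 * (‖u‖ₑ * Dm P (Kset (p n) u)) + 2 * (‖u‖ₑ * Dm P (Kset (q n) u))) := by
    intro n
    have h1 := measurable_Dm_Kset P (p n)
    have h2 := measurable_Dm_Kset P (q n)
    fun_prop
  have hB : ∫⁻ u, ‖u‖ₑ * Bf P u ∂ν ≤ 4 * M := by
    calc ∫⁻ u, ‖u‖ₑ * Bf P u ∂ν
        ≤ ∫⁻ u, liminf (fun n => 2 * (‖u‖ₑ * Dm P (Kset (p n) u)) + 2 * (‖u‖ₑ * Dm P (Kset (q n) u))) atTop ∂ν := by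
          refine lintegral_mono fun u => ?_
          refine le_liminf_of_le (by isBoundedDefault) ?_
          rcases lt_trichotomy u 0 with hu | hu | hu
          · have : ∀ᶠ n in atTop, u / 2 < q n := hq0.eventually_const_lt (by linarith)
            filter_upwards [this] with n hn
            refine le_trans ?_ le_add_self
            rw [mul_left_comm]
            exact mul_le_mul_right (Bf_le_neg P _ _ (hqI n).2 hn) _
          · simp [hu]
          · have : ∀ᶠ n in atTop, p n < u / 2 := hp0.eventually_lt_const (by linarith)
            filter_upwards [this] with n hn
            refine le_trans ?_ le_self_add
            rw [mul_left_comm]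
            exact mul_le_mul_right (Bf_le_pos P _ _ (hpI n).1 hn) _
      _ ≤ liminf (fun n => ∫⁻ u, (2 * (‖u‖ₑ * Dm P (Kset (p n) u)) + 2 * (‖u‖ₑ * Dm P (Kset (q n) u))) ∂ν) atTop :=
          lintegral_liminf_le hBm
      _ ≤ 4 * M := by
          refine liminf_le_of_frequently_le' (Frequently.of_forall fun n => ?_)
          have h1 := measurable_Dm_Kset P (p n)
          have h2 := measurable_Dm_Kset P (q n)
          rw [lintegral_add_left (by fun_prop), lintegral_const_mul _ h1, lintegral_const_mul _ h2]
          have e1 : K (p n) ≤ M := (hpg n : H (p n) = K (p n)) ▸ hHM _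
          have e2 : K (q n) ≤ M := (hqg n : H (q n) = K (q n)) ▸ hHM _
          calc 2 * K (p n) + 2 * K (q n) ≤ 2 * M + 2 * M := by gcongr
            _ = 4 * M := by ring
  have hKlim : Tendsto (fun n => K (q n)) atTop (𝓝 (K 0)) := by
    refine tendsto_lintegral_of_dominated_convergence (fun u => 8 * (‖u‖ₑ * Bf P u))
      (fun n => measurable_Dm_Kset P (q n)) (fun n => ae_of_all _ fun u => ?_) ?_
      (ae_of_all _ fun u => ?_)
    · rcases eq_or_ne u 0 with rfl | hu
      · simp
      · show ‖u‖ₑ * Dm P (Kset (q n) u) ≤ 8 * (‖u‖ₑ * Bf P u)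
        rw [mul_left_comm]
        exact mul_le_mul_right (Kset_le P _ _ hu) _
    · rw [lintegral_const_mul' _ _ (by simp)]
      refine (ENNReal.mul_lt_top (by simp) (hB.trans_lt (ENNReal.mul_lt_top (by simp) ?_))).ne
      simp [hM]
    · exact ENNReal.Tendsto.const_mul (Kset_tendsto (Dm P) u q (fun n => (hqI n).2) hq0) (Or.inr (by simp))
  have hHlim : Tendsto (fun n => H (q n)) atTop (𝓝 (H 0)) := by
    have hm := measurable_hfun P μ
    refine tendsto_lintegral_of_dominated_convergence (fun _ => M)
      (fun n => by fun_prop) (fun n => ae_of_all _ fun a => ?_) (by simp [hM])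
      (ae_of_all _ fun a => ?_)
    · exact ENNReal.ofReal_le_ofReal (hfun_le P μ hP _)
    · rw [add_zero]
      exact (ENNReal.continuous_ofReal.tendsto _).comp
        (hfun_tendsto P μ hP a q (fun n => (hqI n).2) hq0)
  have hfin : H 0 = K 0 := by
    refine tendsto_nhds_unique hHlim ?_
    have : (fun n => H (q n)) = fun n => K (q n) := funext fun n => hqg n
    rw [this]; exact hKlim
  simpa [H, K] using hfin

lemma final_real (P : Measure ℝ) [IsProbabilityMeasure P] (μ : ℝ) (ν : Measure ℝ) [SFinite ν]
    (hP : Integrable (fun x : ℝ => x) P) (hμ : ∫ x, x ∂P = μ)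
    (hae : ∀ᵐ a : ℝ, ENNReal.ofReal (hfun P μ a) = kfun P ν a)
    (F : ℝ → ℝ) (hF : ∀ x : ℝ, F x = (P (Iic x)).toReal) :
    ∫ x, (x - μ) * F x ∂P = ∫ x, (∫ u : ℝ, u * (F (x + u) - F x) ∂ν) ∂P := by
  have hPμ : Integrable (fun x : ℝ => x - μ) P := hP.sub (integrable_const _)
  have hmain := main_eq P μ ν hP hae
  have hhm := measurable_hfun P μ
  have hhn := hfun_nonneg P μ hP hμ
  -- left-hand side
  have hL : ∫ x, (x - μ) * F x ∂P = (∫⁻ a, ENNReal.ofReal (hfun P μ a) ∂P).toReal := by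
    rw [← integral_eq_lintegral_of_nonneg_ae (ae_of_all _ hhn) hhm.aestronglyMeasurable]
    let f : ℝ → ℝ → ℝ := fun x a => (Iic x).indicator (fun _ => x - μ) a
    have e1 : ∀ x, (x - μ) * F x = ∫ a, f x a ∂P := by
      intro x
      simp only [f]
      rw [integral_indicator measurableSet_Iic, setIntegral_const, hF, smul_eq_mul, mul_comm]
      rfl
    have e2 : ∀ a, hfun P μ a = ∫ x, f x a ∂P := by
      intro a
      unfold hfun
      rw [← integral_indicator measurableSet_Ici]
      rfl
    simp_rw [e1, e2]
    apply integral_integral_swap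
    have hs : MeasurableSet {p : ℝ × ℝ | p.2 ≤ p.1} := measurableSet_le (by fun_prop) (by fun_prop)
    have h1 : Integrable (fun p : ℝ × ℝ => p.1 - μ) (P.prod P) := hPμ.comp_fst P
    exact h1.indicator hs
  -- right-hand side
  have hm : Measurable (fun p : ℝ × ℝ => P (uIoc p.1 (p.1 + p.2))) := by
    have : ∀ p : ℝ × ℝ, uIoc p.1 (p.1 + p.2) = Prod.mk p ⁻¹' ({q : (ℝ × ℝ) × ℝ | min q.1.1 (q.1.1 + q.1.2) < q.2} ∩ {q | q.2 ≤ max q.1.1 (q.1.1 + q.1.2)}) := fun p => rfl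
    simp_rw [this]
    exact measurable_measure_prodMk_left ((measurableSet_lt (by fun_prop) (by fun_prop)).inter
      (measurableSet_le (by fun_prop) (by fun_prop)))
  have hm2 : Measurable (fun p : ℝ × ℝ => ‖p.2‖ₑ * P (uIoc p.1 (p.1 + p.2))) :=
    (by fun_prop : Measurable fun p : ℝ × ℝ => ‖p.2‖ₑ).mul hm
  let G : ℝ → ENNReal := fun x => ∫⁻ u, ‖u‖ₑ * P (uIoc x (x + u)) ∂ν
  have hGm : Measurable G := Measurable.lintegral_prod_right' hm2
  have hdiff : ∀ x y : ℝ, x ≤ y → F y - F x = (P (Ioc x y)).toReal := by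
    intro x y hxy
    have hd : Ioc x y = Iic y \ Iic x := by ext z; simp [and_comm]
    rw [hF, hF, hd, measure_diff (Iic_subset_Iic.2 hxy) measurableSet_Iic.nullMeasurableSet
      (measure_ne_top _ _), ENNReal.toReal_sub_of_le (measure_mono (Iic_subset_Iic.2 hxy)) (measure_ne_top _ _)]
  have hpt : ∀ x u : ℝ, u * (F (x + u) - F x) = (‖u‖ₑ * P (uIoc x (x + u))).toReal := by
    intro x u
    rw [ENNReal.toReal_mul, toReal_enorm, Real.norm_eq_abs]
    rcases le_total 0 u with h | h
    · rw [hdiff _ _ (by linarith), abs_of_nonneg h, uIoc_of_le (by linarith)]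
    · rw [abs_of_nonpos h, uIoc_of_ge (by linarith), ← hdiff _ _ (by linarith)]; ring
  have hinner : ∀ x, ∫ u : ℝ, u * (F (x + u) - F x) ∂ν = (G x).toReal := by
    intro x
    simp_rw [hpt]
    rw [integral_toReal]
    · exact (hm2.comp (measurable_prodMk_left (x := x))).aemeasurable
    · exact ae_of_all _ fun u => ENNReal.mul_lt_top (by simp) (measure_lt_top _ _)
  have hG : ∫⁻ x, G x ∂P = ∫⁻ u, ‖u‖ₑ * Dm P (Kset 0 u) ∂ν := by
    simp only [G]
    rw [lintegral_lintegral_swap hm2.aemeasurable]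
    congr 1; ext u
    have hmu : Measurable (fun x : ℝ => P (uIoc x (x + u))) := hm.comp (measurable_prodMk_right (y := u))
    rw [lintegral_const_mul _ hmu, Dm_Kset]
    congr 1
    simp only [add_zero]
    have hs : MeasurableSet {p : ℝ × ℝ | p.2 ∈ Kset p.1 u} :=
      (by fun_prop : Measurable fun p : ℝ × ℝ => ((p.1, u), p.2)) measurableSet_triple
    have h1 := Measure.prod_apply (μ := P) (ν := P) hs
    have h2 := Measure.prod_apply_symm (μ := P) (ν := P) hs
    have h3 : ∀ x : ℝ, uIoc x (x + u) = (fun a => (a, x)) ⁻¹' {p : ℝ × ℝ | p.2 ∈ Kset p.1 u} := by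
      intro x; ext a; exact (mem_Kset a u x).symm
    simp_rw [h3]
    rw [← h2, h1]
    rfl
  have hfin : ∫⁻ x, G x ∂P ≠ ⊤ := by
    rw [hG, ← hmain]
    refine ne_top_of_le_ne_top (b := ENNReal.ofReal (∫ x, |x - μ| ∂P)) (by simp) ?_
    calc _ ≤ ∫⁻ _, ENNReal.ofReal (∫ x, |x - μ| ∂P) ∂P :=
          lintegral_mono fun a => ENNReal.ofReal_le_ofReal (hfun_le P μ hP _)
      _ = _ := by simp
  simp_rw [hinner]
  rw [integral_toReal hGm.aemeasurable (ae_lt_top hGm hfin), hL, hmain, hG]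

end GiniAux

/-- **Gini coefficient representation for infinitely divisible distributions.**
If `X ~ IDD(μ, 0, ν)` with `μ = E[X] > 0` and `∫ u² ν(du) < ∞`, and `F_X` is the
cumulative distribution function of `X`, then the Gini coefficient
`G = (2/μ) Cov(X, F_X(X))` admits the representation
`G = (2/μ) E[∫ u (F_X(X+u) - F_X(X)) ν(du)]`. -/
theorem gini_coefficient_IDD
    {Ω : Type*} [MeasureSpace Ω] [IsProbabilityMeasure (ℙ : Measure Ω)]
    (X : Ω → ℝ) (hX : Measurable X) (hXint : Integrable X ℙ)
    (μ : ℝ) (ν : Measure ℝ)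
    (hν0 : ν {0} = 0)
    (hνfin : ∫⁻ u : ℝ, ENNReal.ofReal (min 1 (u ^ 2)) ∂ν < ⊤)
    -- X ~ IDD(μ, 0, ν)
    (hcf : ∀ t : ℝ,
      ∫ ω, Complex.exp (Complex.I * t * X ω) ∂ℙ
        = Complex.exp (Complex.I * t * μ
            + ∫ u : ℝ, (Complex.exp (Complex.I * t * u) - 1 - Complex.I * t * u) ∂ν))
    -- μ = E[X] > 0 and ∫ u² ν(du) < ∞
    (hμ : μ = ∫ ω, X ω ∂ℙ) (hμpos : 0 < μ)
    (hν2 : Integrable (fun u : ℝ => u ^ 2) ν)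
    -- F is the cumulative distribution function of X
    (F : ℝ → ℝ)
    (hF : ∀ x : ℝ, F x = (ℙ {ω | X ω ≤ x}).toReal) :
    (2 / μ) * ((∫ ω, X ω * F (X ω) ∂ℙ) - (∫ ω, X ω ∂ℙ) * (∫ ω, F (X ω) ∂ℙ))
      = (2 / μ) * ∫ ω, (∫ u : ℝ, u * (F (X ω + u) - F (X ω)) ∂ν) ∂ℙ := by
  have : SFinite ν := aux_sfinite ν hν0 hν2
  let P : Measure ℝ := Measure.map X ℙ
  have hprob : IsProbabilityMeasure P := Measure.isProbabilityMeasure_map hX.aemeasurable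
  have hmap : ∀ {E : Type} [NormedAddCommGroup E] [NormedSpace ℝ E] (f : ℝ → E),
      StronglyMeasurable f → ∫ x, f x ∂P = ∫ ω, f (X ω) ∂ℙ := fun f hf =>
    integral_map hX.aemeasurable hf.aestronglyMeasurable
  have hP : Integrable (fun x : ℝ => x) P := by
    rw [integrable_map_measure (by fun_prop) hX.aemeasurable]; exact hXint
  have hμP : ∫ x, x ∂P = μ := by
    rw [hmap (fun x => x) stronglyMeasurable_id, hμ]
  have hcfP : ∀ t : ℝ,
      ∫ x : ℝ, Complex.exp (Complex.I * t * x) ∂P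
        = Complex.exp (Complex.I * t * μ
            + ∫ u : ℝ, (Complex.exp (Complex.I * t * u) - 1 - Complex.I * t * u) ∂ν) := by
    intro t
    rw [← hcf t]
    exact hmap (fun x : ℝ => Complex.exp (Complex.I * t * x)) (by fun_prop)
  have hFP : ∀ x, F x = (P (Iic x)).toReal := by
    intro x
    rw [hF, Measure.map_apply hX measurableSet_Iic]
    rfl
  have hFmono : Monotone F := by
    intro x y hxy
    rw [hFP, hFP]
    exact ENNReal.toReal_mono (measure_ne_top _ _) (measure_mono (Iic_subset_Iic.2 hxy))
  have hFm : Measurable F := hFmono.measurable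
  have hFb : ∀ x, ‖F x‖ ≤ 1 := by
    intro x
    rw [hFP, Real.norm_eq_abs, abs_of_nonneg ENNReal.toReal_nonneg]
    exact ENNReal.toReal_le_of_le_ofReal zero_le_one (by simpa using prob_le_one)
  have key := final_real P μ ν hP hμP (hfun_ae_eq_kfun P μ ν hP hμP hν2 hcfP) F hFP
  have hFi : Integrable F P := Integrable.of_bound hFm.aestronglyMeasurable 1 (ae_of_all _ hFb)
  have hxF : Integrable (fun x => x * F x) P :=
    hP.mul_bdd hFm.aestronglyMeasurable (ae_of_all _ hFb)
  congr 1
  have hsm : StronglyMeasurable (fun x : ℝ => ∫ u : ℝ, u * (F (x + u) - F x) ∂ν) := by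
    have : Measurable (fun p : ℝ × ℝ => p.2 * (F (p.1 + p.2) - F p.1)) := by fun_prop
    exact this.stronglyMeasurable.integral_prod_right'
  rw [← hmap (fun x => ∫ u : ℝ, u * (F (x + u) - F x) ∂ν) hsm, ← key,
    ← hmap (fun x => x * F x) (by fun_prop), ← hmap F (by fun_prop), ← hμ]
  simp_rw [sub_mul]
  rw [integral_sub hxF (hFi.const_mul _), integral_const_mul]
end
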